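/- arXiv:math/0404195 — 6 statements merged into one kernel-verified Lean document; each statement's English description precedes it below -/
import Mathlib

section
/- Let T be a tree, i.e. a connected acyclic simple graph on a vertex set V, and let a group G act on V so that for every g ∈ G and all u, w ∈ V, u and w are adjacent in T if and only if g•u and g•w are adjacent in T. Assume that for every vertex v and every g ∈ G the graph distance dist(v, g•v) is even. Then V is the disjoint union of two G-invariant subsets X₀ and X₁ such that every edge of T has exactly one endpoint in X₀ and one endpoint in X₁. -/
/-- Let `T` be a tree (a connected acyclic simple graph) on a vertex set `V`,
and let a group `G` act on `V` preserving adjacency. Assume that for every vertex `v` and every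
`g ∈ G` the graph distance `dist (v, g • v)` is even. Then `V` is the disjoint union of two
`G`-invariant subsets `X₀` and `X₁` such that every edge of `T` has exactly one endpoint in `X₀`
and one endpoint in `X₁`. -/
theorem tree_even_action_bipartition {V G : Type*} [Group G] [MulAction G V]
    (T : SimpleGraph V) (hconn : T.Connected) (hacyc : T.IsAcyclic)
    (hact : ∀ (g : G) (u w : V), T.Adj u w ↔ T.Adj (g • u) (g • w))
    (heven : ∀ (g : G) (v : V), Even (T.dist v (g • v))) :
    ∃ X₀ X₁ : Set V, X₀ ∩ X₁ = ∅ ∧ X₀ ∪ X₁ = Set.univ ∧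
      (∀ (g : G) (v : V), v ∈ X₀ → g • v ∈ X₀) ∧
      (∀ (g : G) (v : V), v ∈ X₁ → g • v ∈ X₁) ∧
      (∀ u w : V, T.Adj u w → (u ∈ X₀ ∧ w ∈ X₁) ∨ (u ∈ X₁ ∧ w ∈ X₀)) := by
  let c : T.Coloring Bool := hacyc.colorable_two.toColoring (by simp)
  have hc (g : G) (v : V) : c v ↔ c (g • v) := by
    obtain ⟨p, hp⟩ := hconn.exists_walk_length_eq_dist v (g • v)
    exact (c.even_length_iff_congr p).mp (hp ▸ heven g v)
  refine ⟨{v | c v}, {v | ¬ c v}, Set.inter_compl_self _, Set.union_compl_self _,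
    fun g v => (hc g v).mp, fun g v => mt (hc g v).mpr, fun u w h => ?_⟩
  have := c.valid h
  simp only [Set.mem_ofPred_eq]
  grind
end

section
/- For every real number x > 1 there is a real number q such that 1 < q ≤ (1/7)·(6·(2·ln x/ln 7)^(1/2) + 31), and such that, setting τ = (7q − 1)/(q − 1), one has ln(φ_τ(x)) ≤ 2·(2·(ln 7)·(ln x))^(1/2) + 4·ln 7 + 1. -/
/-- For a real number `τ > 1` and a real `x > 0`,
`φ_τ(x) = (1/(τ−1)) · inf { τ^(2m+2) · x^(1/m) : m a positive integer }`. -/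
noncomputable def phiCS (τ x : ℝ) : ℝ :=
  (1 / (τ - 1)) * ⨅ m : ℕ+, τ ^ (2 * (m : ℕ) + 2) * x ^ ((1 : ℝ) / ((m : ℕ) : ℝ))

theorem phiCS_nonneg {τ x : ℝ} (hτ : 1 ≤ τ) (hx : 0 ≤ x) : 0 ≤ phiCS τ x :=
  mul_nonneg (one_div_nonneg.mpr (by linarith)) (Real.iInf_nonneg fun _ => by positivity)

theorem phiCS_le_of_two_le {τ x : ℝ} (hτ : 2 ≤ τ) (hx : 0 ≤ x) (m : ℕ+) :
    phiCS τ x ≤ τ ^ (2 * (m : ℕ) + 2) * x ^ ((1 : ℝ) / ((m : ℕ) : ℝ)) := by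
  have hinf : (⨅ m : ℕ+, τ ^ (2 * (m : ℕ) + 2) * x ^ ((1 : ℝ) / ((m : ℕ) : ℝ)))
      ≤ τ ^ (2 * (m : ℕ) + 2) * x ^ ((1 : ℝ) / ((m : ℕ) : ℝ)) := by
    refine ciInf_le ⟨0, ?_⟩ m
    rintro _ ⟨k, rfl⟩
    positivity
  have hfac : 1 / (τ - 1) ≤ 1 := by
    rw [div_le_one (by linarith)]
    linarith
  exact (mul_le_of_le_one_left (Real.iInf_nonneg fun _ => by positivity) hfac).trans hinf

theorem log_phiCS_le_max {τ x : ℝ} (hτ : 2 ≤ τ) (hx : 0 < x) (m : ℕ+) :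
    Real.log (phiCS τ x)
      ≤ max 0 ((2 * (m : ℕ) + 2) * Real.log τ + Real.log x / (m : ℕ)) := by
  rcases (phiCS_nonneg (by linarith : 1 ≤ τ) hx.le).eq_or_lt with h | h
  · simp [← h]
  · refine le_max_of_le_right ((Real.log_le_log h (phiCS_le_of_two_le hτ hx.le m)).trans_eq ?_)
    rw [Real.log_mul (by positivity) (by positivity), Real.log_pow, Real.log_rpow hx]
    push_cast
    ring

/-- For every real number `x > 1` there is a real number `q` such that
`1 < q ≤ (1/7)·(6·(2·ln x/ln 7)^(1/2) + 31)`, and such that, setting `τ = (7q − 1)/(q − 1)`,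
one has `ln (φ_τ(x)) ≤ 2·(2·(ln 7)·(ln x))^(1/2) + 4·ln 7 + 1`. -/
theorem exists_q_log_phiCS_le (x : ℝ) (hx : 1 < x) :
    ∃ q : ℝ, 1 < q ∧
      q ≤ (1 / 7) * (6 * Real.sqrt (2 * Real.log x / Real.log 7) + 31) ∧
      Real.log (phiCS ((7 * q - 1) / (q - 1)) x)
        ≤ 2 * Real.sqrt (2 * Real.log 7 * Real.log x) + 4 * Real.log 7 + 1 := by
  set L := Real.log 7
  set X := Real.log x
  have hLpos : 0 < L := Real.log_pos (by norm_num)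
  have hXpos : 0 < X := Real.log_pos hx
  set S := Real.sqrt (2 * X / L) with hS
  have hSpos : 0 < S := Real.sqrt_pos.mpr (by positivity)
  have hSX : 2 * X = L * S ^ 2 := by
    rw [hS, Real.sq_sqrt (by positivity)]
    field_simp
  have hLS : Real.sqrt (2 * L * X) = L * S := by
    rw [show 2 * L * X = (L * S) ^ 2 by linear_combination L * hSX]
    exact Real.sqrt_sq (by positivity)
  refine ⟨(1 / 7) * (6 * S + 31), by linarith, le_rfl, ?_⟩
  rw [show (7 * (1 / 7 * (6 * S + 31)) - 1) / (1 / 7 * (6 * S + 31) - 1) = 7 * (1 + 1 / (S + 4)) by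
    rw [div_eq_iff (by linarith)]
    field_simp
    ring, hLS]
  have hinv : 0 < 1 / (S + 4) := by positivity
  have hlog : Real.log (7 * (1 + 1 / (S + 4))) ≤ L + 1 / (S + 4) := by
    rw [Real.log_mul (by norm_num) (by positivity)]
    linarith [Real.log_le_sub_one_of_pos (show 0 < 1 + 1 / (S + 4) by positivity)]
  set m : ℕ := ⌈S / 2⌉₊
  have hm0 : 0 < m := Nat.ceil_pos.mpr (by positivity)
  have hle : S / 2 ≤ m := Nat.le_ceil _
  have hlt : (m : ℝ) < S / 2 + 1 := Nat.ceil_lt_add_one (by positivity)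
  have hm1 : (1 : ℝ) ≤ m := by exact_mod_cast hm0
  refine (log_phiCS_le_max (by linarith) (by linarith) ⟨m, hm0⟩).trans
    (max_le (by positivity) ?_)
  have hτ : (2 * (m : ℝ) + 2) * Real.log (7 * (1 + 1 / (S + 4))) ≤ (2 * m + 2) * L + 1 := by
    have hone : (2 * (m : ℝ) + 2) * (1 / (S + 4)) ≤ 1 := by
      rw [mul_one_div, div_le_one (by positivity)]
      linarith
    linarith [mul_le_mul_of_nonneg_left hlog (by positivity : (0 : ℝ) ≤ 2 * m + 2)]
  have hXm : X / m ≤ 2 * L * (S - m + 1) := by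
    rw [div_le_iff₀ (by positivity)]
    have hsq : (m - S / 2) ^ 2 ≤ (m : ℝ) := by nlinarith
    linarith [mul_le_mul_of_nonneg_left hsq hLpos.le]
  simp only [PNat.mk_coe]
  linarith
end

section
/- Define a function f on the real interval (1, ∞) by f(x) = 2·(2·(ln 7)·(ln x))^(1/2) + ln(6·(2·ln x/ln 7)^(1/2) + 31) + ln(ln x/ln 2 + 1) − ln x. Then for all integers m and n with m ≥ n ≥ 333, one has f(m) ≤ f(n). -/
/-- The function `f` on `(1, ∞)` given by
`f(x) = 2·(2·(ln 7)·(ln x))^(1/2) + ln(6·(2·ln x/ln 7)^(1/2) + 31) + ln(ln x/ln 2 + 1) − ln x`. -/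
noncomputable def fCS (x : ℝ) : ℝ :=
  2 * Real.sqrt (2 * Real.log 7 * Real.log x) +
    Real.log (6 * Real.sqrt (2 * Real.log x / Real.log 7) + 31) +
    Real.log (Real.log x / Real.log 2 + 1) - Real.log x

open Real

lemma log_sub_log_le_sub_div {x y : ℝ} (hx : 0 < x) (hy : 0 < y) :
    log y - log x ≤ (y - x) / x := by
  rw [← log_div hy.ne' hx.ne', sub_div, div_self hx.ne']
  exact log_le_sub_one_of_pos (div_pos hy hx)

lemma four_mul_log_seven_eq :
    4 * log 7 = 5 * log 2 + log 3 + 2 * log 5 + log (2401 / 2400) := by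
  have h : log ((7 : ℝ) ^ 4) = log (2 ^ 5 * 3 * 5 ^ 2 * (2401 / 2400)) := by norm_num
  rw [log_mul (by norm_num) (by norm_num), log_mul (by norm_num) (by norm_num),
    log_mul (by norm_num) (by norm_num), log_pow, log_pow, log_pow] at h
  exact_mod_cast h

lemma log_seven_lt : log 7 < 1.94592 := by
  have h := log_le_sub_one_of_pos (x := 2401 / 2400) (by norm_num)
  linarith [four_mul_log_seven_eq, log_two_lt_d9, log_three_lt_d9, log_five_lt_d9]

lemma lt_log_seven : 1.9458 < log 7 := by
  have h := log_nonneg (x := 2401 / 2400) (by norm_num)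
  linarith [four_mul_log_seven_eq, log_two_gt_d9, log_three_gt_d9, log_five_gt_d9]

lemma lt_log_333 : 5.80814 < log 333 := by
  have h : log 333 = log (2 ^ 3 * 5 ^ 3 * (999 / 1000) / 3) := by norm_num
  rw [log_div (by norm_num) (by norm_num), log_mul (by norm_num) (by norm_num),
    log_mul (by norm_num) (by norm_num), log_pow, log_pow] at h
  push_cast at h
  linarith [one_sub_inv_le_log_of_pos (x := 999 / 1000) (by norm_num),
    log_two_gt_d9, log_three_lt_d9, log_five_gt_d9]

lemma lt_log_334 : 5.8111 < log 334 := by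
  have h : log 334 = log (333 * (334 / 333)) := by norm_num
  rw [log_mul (by norm_num) (by norm_num)] at h
  linarith [one_sub_inv_le_log_of_pos (x := 334 / 333) (by norm_num), lt_log_333]

/-- With `a = √(2 ln 7)`, the function `fCS` is an explicit function of `s = √(ln x)`. -/
lemma fCS_eq_of_sq_eq_log {x s a : ℝ} (hs : 0 < s) (ha : 0 < a) (hsx : s ^ 2 = log x)
    (ha7 : a ^ 2 = 2 * log 7) :
    fCS x = 2 * (a * s) + (log (12 * s + 31 * a) - log a) +
      (log (s ^ 2 + log 2) - log (log 2)) - s ^ 2 := by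
  have hl : 0 < log 2 := log_pos (by norm_num)
  have h1 : √(2 * log 7 * log x) = a * s := by
    rw [← hsx, ← ha7, ← mul_pow, sqrt_sq (by positivity)]
  have h2 : √(2 * log x / log 7) = 2 * s / a := by
    rw [← hsx, show log 7 = a ^ 2 / 2 by linarith,
      show 2 * s ^ 2 / (a ^ 2 / 2) = (2 * s / a) ^ 2 by field_simp,
      sqrt_sq (by positivity)]
  rw [fCS, h1, h2, ← hsx, ← log_div (by positivity) ha.ne', ← log_div (by positivity) hl.ne',
    show 6 * (2 * s / a) + 31 = (12 * s + 31 * a) / a by field_simp; ring,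
    show s ^ 2 / log 2 + 1 = (s ^ 2 + log 2) / log 2 by field_simp]

lemma secant_slope_bound_nonpos {a s t l : ℝ} (ha : 1.9727 ≤ a) (ha' : a ≤ 1.97278)
    (hs : 2.41 ≤ s) (ht : 2.41062 ≤ t) (hl : 0.6931 ≤ l) :
    2 * a + 12 / (12 * s + 31 * a) + (t + s) / (s ^ 2 + l) - (t + s) ≤ 0 := by
  have h1 : 12 / (12 * s + 31 * a) ≤ 0.13323 := by
    rw [div_le_iff₀ (by linarith)]
    linarith
  have h2 : (t + s) / (s ^ 2 + l) ≤ (t + s) * 0.15382 := by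
    rw [div_le_iff₀ (by positivity), mul_assoc]
    exact le_mul_of_one_le_right (by linarith) (by nlinarith)
  linarith

/-- For all integers `m` and `n` with `m ≥ n ≥ 333`, one has `f(m) ≤ f(n)`. -/
theorem fCS_antitone_on_integers (m n : ℤ) (h333 : 333 ≤ n) (hnm : n ≤ m) :
    fCS (m : ℝ) ≤ fCS (n : ℝ) := by
  rcases hnm.eq_or_lt with rfl | hlt
  · exact le_rfl
  have hn : (333 : ℝ) ≤ n := by exact_mod_cast h333
  have hm : (334 : ℝ) ≤ m := by exact_mod_cast (by omega : (334 : ℤ) ≤ m)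
  have hnm' : (n : ℝ) ≤ m := by exact_mod_cast hnm
  have hln : log 333 ≤ log n := log_le_log (by norm_num) hn
  have hlm : log 334 ≤ log m := log_le_log (by norm_num) hm
  have h7 := lt_log_seven
  have h7' := log_seven_lt
  have h333' := lt_log_333
  have h334 := lt_log_334
  have hl : 0.6931 ≤ log 2 := by linarith [log_two_gt_d9]
  have ha : 1.9727 ≤ √(2 * log 7) := le_sqrt_of_sq_le (by norm_num; linarith)
  have ha' : √(2 * log 7) ≤ 1.97278 := sqrt_le_iff.2 ⟨by norm_num, by norm_num; linarith⟩
  have hs : 2.41 ≤ √(log n) := le_sqrt_of_sq_le (by norm_num; linarith)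
  have ht : 2.41062 ≤ √(log m) := le_sqrt_of_sq_le (by norm_num; linarith)
  have hst : √(log n) ≤ √(log m) := sqrt_le_sqrt (log_le_log (by linarith) hnm')
  have ha7 : √(2 * log 7) ^ 2 = 2 * log 7 := sq_sqrt (by linarith)
  have hsn : √(log n) ^ 2 = log n := sq_sqrt (by linarith)
  have htm : √(log m) ^ 2 = log m := sq_sqrt (by linarith)
  rw [fCS_eq_of_sq_eq_log (by linarith) (by linarith) hsn ha7,
    fCS_eq_of_sq_eq_log (by linarith) (by linarith) htm ha7]
  generalize √(2 * log 7) = a at *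
  generalize √(log n) = s at *
  generalize √(log m) = t at *
  have h1 := log_sub_log_le_sub_div (x := 12 * s + 31 * a) (y := 12 * t + 31 * a)
    (by linarith) (by linarith)
  have h2 := log_sub_log_le_sub_div (x := s ^ 2 + log 2) (y := t ^ 2 + log 2)
    (by positivity) (by positivity)
  have h3 := mul_nonpos_of_nonneg_of_nonpos (sub_nonneg.2 hst)
    (secant_slope_bound_nonpos ha ha' hs ht hl)
  have h4 : (t - s) * (2 * a + 12 / (12 * s + 31 * a) + (t + s) / (s ^ 2 + log 2) - (t + s)) =
      2 * (a * t) - 2 * (a * s) + (12 * t + 31 * a - (12 * s + 31 * a)) / (12 * s + 31 * a) +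
      (t ^ 2 + log 2 - (s ^ 2 + log 2)) / (s ^ 2 + log 2) - (t ^ 2 - s ^ 2) := by
    ring
  linarith
end

section
/- Let Γ be a finite simple graph none of whose connected components is acyclic, and let Γ₀ be a subgraph of Γ. Then χ(Γ₀) ≥ χ(Γ), i.e. |V(Γ₀)| − |E(Γ₀)| ≥ |V(Γ)| − |E(Γ)|. -/
namespace SimpleGraph

variable {V : Type*} {G F : SimpleGraph V}

/-- A neighbour on a geodesic is strictly closer to the target. -/
lemma Reachable.exists_adj_dist_lt {u v : V} (h : G.Reachable u v) (hne : u ≠ v) :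
    ∃ w, G.Adj u w ∧ G.dist w v < G.dist u v := by
  obtain ⟨p, hp⟩ := h.exists_walk_length_eq_dist
  cases p with
  | nil => exact absurd rfl hne
  | cons hadj q =>
    refine ⟨_, hadj, ?_⟩
    have := dist_le q
    rw [Walk.length_cons] at hp
    omega

/-- A cycle of a graph uses an edge outside any given acyclic graph. -/
lemma Walk.IsCycle.exists_adj_not_adj_of_isAcyclic {w : V} {p : G.Walk w w} (hp : p.IsCycle)
    (hF : F.IsAcyclic) : ∃ x y, G.Reachable w x ∧ G.Adj x y ∧ ¬ F.Adj x y := by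
  classical
  by_contra! hcon
  have hedges : ∀ e ∈ p.edges, e ∈ F.edgeSet := by
    intro e he
    induction e with
    | h a b =>
      exact hcon a b (p.takeUntil a (p.fst_mem_support_of_mem_edges he)).reachable
        (p.adj_of_mem_edges he)
  exact hF _ (hp.transfer hedges)

/-- If every component contains a cycle, then the vertices can be assigned pairwise distinct
incident edges. -/
lemma exists_adj_injective_of_forall_exists_isCycle
    (hcyc : ∀ v : V, ∃ w : V, G.Reachable v w ∧ ∃ p : G.Walk w w, p.IsCycle) :
    ∃ f : V → V, (∀ v, G.Adj v (f v)) ∧ Function.Injective fun v ↦ s(v, f v) := by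
  obtain ⟨F, hFG, hF, hreach⟩ := G.exists_isAcyclic_reachable_eq_le
  have hroot : ∀ c : G.ConnectedComponent, ∃ x y,
      G.connectedComponentMk x = c ∧ G.Adj x y ∧ ¬ F.Adj x y := by
    intro c
    induction c using ConnectedComponent.ind with
    | h v =>
      obtain ⟨w, hvw, p, hp⟩ := hcyc v
      obtain ⟨x, y, hwx, hxy, hn⟩ := hp.exists_adj_not_adj_of_isAcyclic hF
      exact ⟨x, y, ConnectedComponent.sound (hvw.trans hwx).symm, hxy, hn⟩
  choose x y hx hxy hnF using hroot
  have hparent : ∀ v, ∃ w, G.Adj v w ∧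
      ((v = x (G.connectedComponentMk v) ∧ ¬ F.Adj v w) ∨
        (F.Adj v w ∧ F.dist w (x (G.connectedComponentMk v)) <
          F.dist v (x (G.connectedComponentMk v)))) := by
    intro v
    by_cases hv : v = x (G.connectedComponentMk v)
    · refine ⟨y (G.connectedComponentMk v), ?_, .inl ⟨hv, ?_⟩⟩
      · have := hxy (G.connectedComponentMk v)
        rwa [← hv] at this
      · have := hnF (G.connectedComponentMk v)
        rwa [← hv] at this
    · have hr : F.Reachable v (x (G.connectedComponentMk v)) := by
        rw [hreach]
        exact (ConnectedComponent.exact (hx _)).symm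
      obtain ⟨w, hw, hlt⟩ := hr.exists_adj_dist_lt hv
      exact ⟨w, hFG hw, .inr ⟨hw, hlt⟩⟩
  choose f hadj hf using hparent
  refine ⟨f, hadj, fun v w hvw ↦ ?_⟩
  rcases Sym2.eq_iff.1 hvw with ⟨h, -⟩ | ⟨hv, hw⟩
  · exact h
  have hc : G.connectedComponentMk v = G.connectedComponentMk w :=
    ConnectedComponent.sound (hw ▸ (hadj v).reachable)
  have hfv := hf v
  have hfw := hf w
  rw [hw, hc] at hfv
  rw [← hv] at hfw
  rcases hfv with ⟨h₁, h₂⟩ | ⟨h₁, h₂⟩ <;> rcases hfw with ⟨h₃, h₄⟩ | ⟨h₃, h₄⟩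
  · exact h₁.trans h₃.symm
  · exact absurd h₃.symm h₂
  · exact absurd h₁.symm h₄
  · exact absurd h₂ h₄.asymm

end SimpleGraph

/-- Let `Γ` be a finite simple graph none of whose connected components is
acyclic (i.e. every vertex is in the same component as some cycle), and let `Γ₀` be a subgraph
of `Γ`.  Then `χ(Γ₀) ≥ χ(Γ)`, i.e. `|V(Γ₀)| − |E(Γ₀)| ≥ |V(Γ)| − |E(Γ)|`. -/
theorem eulerChar_subgraph_ge {V : Type*} [Fintype V] (Γ : SimpleGraph V)
    (hcyc : ∀ v : V, ∃ w : V, Γ.Reachable v w ∧ ∃ p : Γ.Walk w w, p.IsCycle)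
    (Γ₀ : Γ.Subgraph) :
    (Fintype.card V : ℤ) - (Γ.edgeSet.ncard : ℤ)
      ≤ (Γ₀.verts.ncard : ℤ) - (Γ₀.edgeSet.ncard : ℤ) := by
  obtain ⟨f, hadj, hinj⟩ := SimpleGraph.exists_adj_injective_of_forall_exists_isCycle hcyc
  have hle : (Γ₀.vertsᶜ).ncard ≤ (Γ.edgeSet \ Γ₀.edgeSet).ncard :=
    Set.ncard_le_ncard_of_injOn (fun v ↦ s(v, f v))
      (fun v hv ↦ ⟨hadj v, fun h ↦ hv (Γ₀.edge_vert h)⟩) hinj.injOn (Set.toFinite _)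
  have hE := Set.ncard_sdiff_add_ncard_of_subset Γ₀.edgeSet_subset (Set.toFinite _)
  have hV := Set.ncard_add_ncard_compl Γ₀.verts
  rw [Nat.card_eq_fintype_card] at hV
  omega
end

section
/- Let Γ be a nonempty finite simple graph which has at least two vertices and in which every vertex has degree at least 3, and let V denote the number of vertices of Γ. Then Γ contains a connected subgraph H with |E(H)| > |V(H)| (i.e. χ(H) < 0) and with |E(H)| ≤ 4·log₂ V. -/
namespace SimpleGraph

variable {V : Type*} {Γ : SimpleGraph V} {o : V} {p : V → V}

/-- `p` sends every vertex of the component of `o` other than `o` itself to a neighbour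
which is closer to `o`. -/
def IsParentMap (Γ : SimpleGraph V) (o : V) (p : V → V) : Prop :=
  ∀ v, Γ.Reachable o v → v ≠ o → Γ.Adj v (p v) ∧ Γ.dist o (p v) + 1 = Γ.dist o v

theorem exists_isParentMap (Γ : SimpleGraph V) (o : V) : ∃ p, Γ.IsParentMap o p := by
  have key : ∀ v, ∃ u, Γ.Reachable o v → v ≠ o → Γ.Adj v u ∧ Γ.dist o u + 1 = Γ.dist o v := by
    intro v
    by_cases h : Γ.Reachable o v ∧ v ≠ o
    · obtain ⟨hr, hne⟩ := h
      obtain ⟨w, hw⟩ := hr.symm.exists_walk_length_eq_dist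
      cases w with
      | nil => exact absurd rfl hne
      | @cons _ u _ hadj q =>
        refine ⟨u, fun _ _ => ⟨hadj, ?_⟩⟩
        have h1 := dist_le q
        have h2 : Γ.dist v o ≤ Γ.dist u o + 1 := by
          obtain ⟨q', hq'⟩ := q.reachable.exists_walk_length_eq_dist
          have := dist_le (Walk.cons hadj q')
          simpa [hq'] using this
        rw [Walk.length_cons] at hw
        rw [dist_comm (u := o) (v := u), dist_comm (u := o) (v := v)]
        omega
    · exact ⟨v, fun h1 h2 => absurd ⟨h1, h2⟩ h⟩
  choose p hp using key
  exact ⟨p, hp⟩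

namespace IsParentMap

theorem reachable (hp : Γ.IsParentMap o p) {v : V} (hv : Γ.Reachable o v) (hne : v ≠ o) :
    Γ.Reachable o (p v) :=
  hv.trans (hp v hv hne).1.reachable

theorem injOn (hp : Γ.IsParentMap o p) :
    Set.InjOn (fun v => s(v, p v)) {v | Γ.Reachable o v ∧ v ≠ o} := by
  rintro y ⟨hy, hyo⟩ z ⟨hz, hzo⟩ h
  have h1 := (hp y hy hyo).2
  have h2 := (hp z hz hzo).2
  rcases Sym2.eq_iff.1 h with ⟨h, -⟩ | ⟨h, h'⟩
  · exact h
  · rw [h'] at h1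
    rw [← h] at h2
    omega

/-- The non-root vertices on the path from `x` to the root. -/
theorem exists_ancestors [DecidableEq V] (hp : Γ.IsParentMap o p) {x : V}
    (hx : Γ.Reachable o x) :
    ∃ A : Finset V, A.card ≤ Γ.dist o x ∧ x ∈ insert o A ∧
      ∀ y ∈ A, Γ.Reachable o y ∧ y ≠ o ∧ p y ∈ insert o A := by
  induction hn : Γ.dist o x generalizing x with
  | zero =>
    refine ⟨∅, by simp, ?_, by simp⟩
    simp [(hx.dist_eq_zero_iff.1 hn)]
  | succ n ih =>
    have hne : x ≠ o := by
      rintro rfl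
      simp at hn
    obtain ⟨A, hA, hxA, hcl⟩ := ih (hp.reachable hx hne) (by have := (hp x hx hne).2; omega)
    refine ⟨insert x A, (Finset.card_insert_le _ _).trans (by omega), by simp, ?_⟩
    intro y hy
    rcases Finset.mem_insert.1 hy with rfl | hy
    · exact ⟨hx, hne, by grind⟩
    · obtain ⟨h1, h2, h3⟩ := hcl y hy
      exact ⟨h1, h2, by grind⟩

/-- Two edges outside the tree of `p`, together with the tree paths from their endpoints to
the root, span a connected subgraph of negative Euler characteristic. -/
theorem exists_subgraph_of_two_edges (hp : Γ.IsParentMap o p) {a b c d : V}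
    (hab : Γ.Adj a b) (hcd : Γ.Adj c d) (ha : Γ.Reachable o a) (hc : Γ.Reachable o c)
    (hne : s(a, b) ≠ s(c, d))
    (hT : ∀ v, Γ.Reachable o v → v ≠ o → s(v, p v) ≠ s(a, b) ∧ s(v, p v) ≠ s(c, d)) :
    ∃ H : Γ.Subgraph, H.Connected ∧ H.verts.ncard < H.edgeSet.ncard ∧
      H.edgeSet.ncard ≤ Γ.dist o a + Γ.dist o b + Γ.dist o c + Γ.dist o d + 2 := by
  classical
  obtain ⟨A, hA, haA, hAcl⟩ := hp.exists_ancestors ha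
  obtain ⟨B, hB, hbB, hBcl⟩ := hp.exists_ancestors (ha.trans hab.reachable)
  obtain ⟨C, hC, hcC, hCcl⟩ := hp.exists_ancestors hc
  obtain ⟨D, hD, hdD, hDcl⟩ := hp.exists_ancestors (hc.trans hcd.reachable)
  obtain ⟨S, hS⟩ : ∃ S, S = A ∪ B ∪ C ∪ D := ⟨_, rfl⟩
  have hScard : S.card ≤ Γ.dist o a + Γ.dist o b + Γ.dist o c + Γ.dist o d := by
    have h1 := Finset.card_union_le (A ∪ B ∪ C) D
    have h2 := Finset.card_union_le (A ∪ B) C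
    have h3 := Finset.card_union_le A B
    rw [hS]
    omega
  have hScl : ∀ y ∈ S, Γ.Reachable o y ∧ y ≠ o ∧ p y ∈ insert o S := by
    intro y hy
    grind
  have haS : a ∈ insert o S := by grind
  have hbS : b ∈ insert o S := by grind
  have hcS : c ∈ insert o S := by grind
  have hdS : d ∈ insert o S := by grind
  have hoS : o ∉ S := fun h => (hScl o h).2.1 rfl
  clear hAcl hBcl hCcl hDcl
  obtain ⟨T, hTdef⟩ : ∃ T, T = S.image (fun v => s(v, p v)) := ⟨_, rfl⟩
  have hTcard : T.card = S.card := by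
    rw [hTdef]
    exact Finset.card_image_of_injOn
      (hp.injOn.mono fun y hy => And.intro (hScl y hy).1 (hScl y hy).2.1)
  have habT : s(a, b) ∉ T := by
    rw [hTdef, Finset.mem_image]
    rintro ⟨y, hy, h⟩
    exact (hT y (hScl y hy).1 (hScl y hy).2.1).1 h
  have hcdT : s(c, d) ∉ T := by
    rw [hTdef, Finset.mem_image]
    rintro ⟨y, hy, h⟩
    exact (hT y (hScl y hy).1 (hScl y hy).2.1).2 h
  obtain ⟨F, hF⟩ : ∃ F, F = insert s(a, b) (insert s(c, d) T) := ⟨_, rfl⟩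
  have hFcard : F.card = S.card + 2 := by
    rw [hF, Finset.card_insert_of_notMem (by simp [hne, habT]),
      Finset.card_insert_of_notMem hcdT, hTcard]
  have hFΓ : ∀ e ∈ F, e ∈ Γ.edgeSet ∧ ∀ v ∈ e, v ∈ insert o S := by
    intro e he
    simp only [hF, hTdef, Finset.mem_insert, Finset.mem_image] at he
    rcases he with rfl | rfl | ⟨y, hy, rfl⟩
    · refine ⟨hab, fun v hv => ?_⟩
      rcases Sym2.mem_iff.1 hv with rfl | rfl <;> assumption
    · refine ⟨hcd, fun v hv => ?_⟩
      rcases Sym2.mem_iff.1 hv with rfl | rfl <;> assumption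
    · obtain ⟨h1, h2, h3⟩ := hScl y hy
      refine ⟨(hp y h1 h2).1, fun v hv => ?_⟩
      rcases Sym2.mem_iff.1 hv with rfl | rfl
      · exact Finset.mem_insert_of_mem hy
      · exact h3
  let H : Γ.Subgraph :=
    { verts := ↑(insert o S)
      Adj := fun u v => s(u, v) ∈ F
      adj_sub := fun {u v} h => (hFΓ _ h).1
      edge_vert := fun {u v} h => (hFΓ _ h).2 _ (Sym2.mem_mk_left u v)
      symm := ⟨fun u v h => by rwa [Sym2.eq_swap]⟩ }
  have hHe : H.edgeSet = ↑F := by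
    ext e
    induction e with
    | h u v => exact Iff.rfl
  have hHv : H.verts = ↑(insert o S) := rfl
  refine ⟨H, ?_, ?_, ?_⟩
  · have hoH : o ∈ H.verts := by simp [hHv]
    have hreach : ∀ n, ∀ y (hy : y ∈ H.verts), Γ.dist o y = n →
        H.coe.Reachable ⟨o, hoH⟩ ⟨y, hy⟩ := by
      intro n
      induction n with
      | zero =>
        intro y hy hn
        have hyo : y = o := by
          by_contra hyo
          have hyS : y ∈ S := by simpa [hHv, hyo] using hy
          have := (hp y (hScl y hyS).1 hyo).2
          omega
        subst hyo
        exact Reachable.refl _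
      | succ n ih =>
        intro y hy hn
        have hyo : y ≠ o := by
          rintro rfl
          simp at hn
        have hyS : y ∈ S := by simpa [hHv, hyo] using hy
        obtain ⟨h1, h2, h3⟩ := hScl y hyS
        have hpy : p y ∈ H.verts := h3
        have hadj : H.Adj y (p y) := by
          change s(y, p y) ∈ F
          rw [hF, hTdef]
          exact Finset.mem_insert_of_mem
            (Finset.mem_insert_of_mem (Finset.mem_image_of_mem _ hyS))
        refine (ih (p y) hpy (by have := (hp y h1 h2).2; omega)).trans
          (Adj.reachable (G := H.coe) ?_)
        exact hadj.symm
    rw [Subgraph.connected_iff']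
    have : Nonempty H.verts := ⟨⟨o, hoH⟩⟩
    exact ⟨fun u v => (hreach _ u u.2 rfl).symm.trans (hreach _ v v.2 rfl)⟩
  · rw [hHe, hHv, Set.ncard_coe_finset, Set.ncard_coe_finset, hFcard,
      Finset.card_insert_of_notMem hoS]
    omega
  · rw [hHe, Set.ncard_coe_finset, hFcard]
    omega

end IsParentMap

section Ball

variable [Fintype V]

open Classical in
/-- The vertices at distance at most `k` from `o`. -/
noncomputable def closedBallFinset (Γ : SimpleGraph V) (o : V) (k : ℕ) : Finset V :=
  {v | Γ.Reachable o v ∧ Γ.dist o v ≤ k}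

theorem mem_closedBallFinset {k : ℕ} {v : V} :
    v ∈ Γ.closedBallFinset o k ↔ Γ.Reachable o v ∧ Γ.dist o v ≤ k := by
  simp [closedBallFinset]

theorem closedBallFinset_mono {k l : ℕ} (h : k ≤ l) :
    Γ.closedBallFinset o k ⊆ Γ.closedBallFinset o l := by
  intro v hv
  rw [mem_closedBallFinset] at hv ⊢
  exact ⟨hv.1, hv.2.trans h⟩

theorem mem_closedBallFinset_succ_of_adj {k : ℕ} {v w : V} (hv : v ∈ Γ.closedBallFinset o k)
    (h : Γ.Adj v w) : w ∈ Γ.closedBallFinset o (k + 1) := by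
  rw [mem_closedBallFinset] at hv ⊢
  refine ⟨hv.1.trans h.reachable, ?_⟩
  obtain ⟨q, hq⟩ := hv.1.exists_walk_length_eq_dist
  have := dist_le (q.concat h)
  rw [Walk.length_concat] at this
  omega

open Classical in
/-- The edges with at least one endpoint in `B`. -/
noncomputable def touchingEdges (Γ : SimpleGraph V) (B : Finset V) : Finset (Sym2 V) :=
  {e ∈ Γ.edgeFinset | ∃ v ∈ B, v ∈ e}

open Classical in
/-- The edges with both endpoints in `B`. -/
noncomputable def innerEdges (Γ : SimpleGraph V) (B : Finset V) : Finset (Sym2 V) :=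
  {e ∈ Γ.edgeFinset | ∀ v ∈ e, v ∈ B}

theorem mem_touchingEdges {B : Finset V} {e : Sym2 V} :
    e ∈ Γ.touchingEdges B ↔ e ∈ Γ.edgeSet ∧ ∃ v ∈ B, v ∈ e := by
  simp [touchingEdges]

theorem mem_innerEdges {B : Finset V} {e : Sym2 V} :
    e ∈ Γ.innerEdges B ↔ e ∈ Γ.edgeSet ∧ ∀ v ∈ e, v ∈ B := by
  simp [innerEdges]

theorem innerEdges_subset_touchingEdges (Γ : SimpleGraph V) (B : Finset V) :
    Γ.innerEdges B ⊆ Γ.touchingEdges B := by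
  intro e he
  rw [mem_innerEdges] at he
  rw [mem_touchingEdges]
  exact ⟨he.1, e.out.1, he.2 _ e.out_fst_mem, e.out_fst_mem⟩

/-- Summing degrees over `B` counts the edges touching `B` once, and those inside `B` once
more. -/
theorem sum_ncard_neighborSet_le (Γ : SimpleGraph V) (B : Finset V) :
    ∑ v ∈ B, (Γ.neighborSet v).ncard ≤
      (Γ.touchingEdges B).card + (Γ.innerEdges B).card := by
  classical
  calc ∑ v ∈ B, (Γ.neighborSet v).ncard
      = ∑ v ∈ B, ((Γ.touchingEdges B).bipartiteAbove (fun v e => v ∈ e) v).card := by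
        refine Finset.sum_congr rfl fun v hv => ?_
        rw [Set.ncard_eq_toFinset_card', Set.toFinset_card, card_neighborSet_eq_degree,
          ← card_incidenceFinset_eq_degree]
        congr 1
        ext e
        simp only [mem_incidenceFinset, Finset.mem_bipartiteAbove, mem_touchingEdges,
          incidenceSet, Set.mem_ofPred_eq]
        exact ⟨fun h => ⟨⟨h.1, v, hv, h.2⟩, h.2⟩, fun h => ⟨h.1.1, h.2⟩⟩
    _ = ∑ e ∈ Γ.touchingEdges B, (B.bipartiteBelow (fun v e => v ∈ e) e).card :=
        Finset.sum_card_bipartiteAbove_eq_sum_card_bipartiteBelow _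
    _ ≤ ∑ e ∈ Γ.touchingEdges B, (1 + if e ∈ Γ.innerEdges B then 1 else 0) := by
        refine Finset.sum_le_sum fun e he => ?_
        have heΓ := (mem_touchingEdges.1 he).1
        induction e with
        | h a b =>
          have hsub : B.bipartiteBelow (fun v e => v ∈ e) s(a, b) ⊆ {a, b} := by
            intro v hv
            simpa using ((Finset.mem_bipartiteBelow _).1 hv).2
          split_ifs with hin
          · exact (Finset.card_le_card hsub).trans Finset.card_le_two
          · have hnot : ∃ v ∈ s(a, b), v ∉ B := by
              by_contra! h
              exact hin (mem_innerEdges.2 ⟨heΓ, h⟩)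
            obtain ⟨v, hv, hvB⟩ := hnot
            rw [add_zero, Finset.card_le_one]
            intro x hx y hy
            have hxB := ((Finset.mem_bipartiteBelow _).1 hx).1
            have hyB := ((Finset.mem_bipartiteBelow _).1 hy).1
            have hx' := hsub hx
            have hy' := hsub hy
            simp only [Finset.mem_insert, Finset.mem_singleton] at hx' hy'
            rcases Sym2.mem_iff.1 hv with rfl | rfl <;> grind
    _ = (Γ.touchingEdges B).card + (Γ.innerEdges B).card := by
        rw [Finset.sum_add_distrib, Finset.sum_const, smul_eq_mul, mul_one,
          Finset.sum_ite_mem, Finset.inter_eq_right.2 (Γ.innerEdges_subset_touchingEdges B),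
          Finset.sum_const, smul_eq_mul, mul_one]

/-- The tree edges from the sphere of radius `k + 1` down touch the ball of radius `k` without
lying inside it. -/
theorem IsParentMap.card_innerEdges_add_le (hp : Γ.IsParentMap o p) (k : ℕ) :
    (Γ.innerEdges (Γ.closedBallFinset o k)).card + (Γ.closedBallFinset o (k + 1)).card ≤
      (Γ.touchingEdges (Γ.closedBallFinset o k)).card + (Γ.closedBallFinset o k).card := by
  classical
  have hsphere : ∀ v ∈ Γ.closedBallFinset o (k + 1) \ Γ.closedBallFinset o k,
      Γ.Reachable o v ∧ v ≠ o ∧ v ∉ Γ.closedBallFinset o k ∧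
        p v ∈ Γ.closedBallFinset o k := by
    intro v hv
    obtain ⟨hv1, hv2⟩ := Finset.mem_sdiff.1 hv
    have hv3 := mem_closedBallFinset.1 hv1
    have hne : v ≠ o := by
      rintro rfl
      exact hv2 (mem_closedBallFinset.2 ⟨hv3.1, by simp⟩)
    refine ⟨hv3.1, hne, hv2, mem_closedBallFinset.2 ⟨hp.reachable hv3.1 hne, ?_⟩⟩
    have := (hp v hv3.1 hne).2
    omega
  have hcard := Finset.card_image_of_injOn (f := fun v => s(v, p v))
    (s := Γ.closedBallFinset o (k + 1) \ Γ.closedBallFinset o k)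
    (hp.injOn.mono fun v hv => And.intro (hsphere v hv).1 (hsphere v hv).2.1)
  have hdisj : Disjoint (Γ.innerEdges (Γ.closedBallFinset o k))
      ((Γ.closedBallFinset o (k + 1) \ Γ.closedBallFinset o k).image
        fun v => s(v, p v)) := by
    rw [Finset.disjoint_right]
    intro e he hin
    obtain ⟨v, hv, rfl⟩ := Finset.mem_image.1 he
    exact (hsphere v hv).2.2.1 ((mem_innerEdges.1 hin).2 v (Sym2.mem_mk_left _ _))
  have hsub : Γ.innerEdges (Γ.closedBallFinset o k) ∪
      ((Γ.closedBallFinset o (k + 1) \ Γ.closedBallFinset o k).image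
        fun v => s(v, p v)) ⊆ Γ.touchingEdges (Γ.closedBallFinset o k) := by
    refine Finset.union_subset (Γ.innerEdges_subset_touchingEdges _) fun e he => ?_
    obtain ⟨v, hv, rfl⟩ := Finset.mem_image.1 he
    obtain ⟨h1, h2, -, h3⟩ := hsphere v hv
    exact mem_touchingEdges.2 ⟨(hp v h1 h2).1, p v, h3, Sym2.mem_mk_right _ _⟩
  have h1 := Finset.card_le_card hsub
  rw [Finset.card_union_of_disjoint hdisj, hcard] at h1
  have h2 := Finset.card_sdiff_add_card_eq_card
    (closedBallFinset_mono (Γ := Γ) (o := o) (Nat.le_succ k))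
  simp only [Nat.succ_eq_add_one] at h2
  omega

/-- If there are more edges touching the ball of radius `k` than vertices in the ball of radius
`k + 1`, then there is a short connected subgraph of negative Euler characteristic. -/
theorem IsParentMap.exists_subgraph_of_card_lt (hp : Γ.IsParentMap o p) {k : ℕ}
    (h : (Γ.closedBallFinset o (k + 1)).card <
      (Γ.touchingEdges (Γ.closedBallFinset o k)).card) :
    ∃ H : Γ.Subgraph, H.Connected ∧ H.verts.ncard < H.edgeSet.ncard ∧
      H.edgeSet.ncard ≤ 4 * (k + 1) := by
  classical
  obtain ⟨T, hT⟩ : ∃ T, T = ((Γ.closedBallFinset o (k + 1)).erase o).image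
      fun v => s(v, p v) := ⟨_, rfl⟩
  have ho : o ∈ Γ.closedBallFinset o (k + 1) := mem_closedBallFinset.2 ⟨.refl _, by simp⟩
  have hTcard : T.card + 1 ≤ (Γ.closedBallFinset o (k + 1)).card := by
    rw [← Finset.card_erase_add_one ho, hT]
    exact Nat.add_le_add_right Finset.card_image_le 1
  have hend : ∀ e ∈ Γ.touchingEdges (Γ.closedBallFinset o k) \ T, ∃ a b, e = s(a, b) ∧
      Γ.Adj a b ∧ Γ.Reachable o a ∧ Γ.dist o a + Γ.dist o b ≤ 2 * k + 1 ∧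
      ∀ v, Γ.Reachable o v → v ≠ o → s(v, p v) ≠ e := by
    intro e he
    obtain ⟨he, heT⟩ := Finset.mem_sdiff.1 he
    obtain ⟨heΓ, a, ha, hae⟩ := mem_touchingEdges.1 he
    obtain ⟨b, rfl⟩ := hae
    have hb : b ∈ Γ.closedBallFinset o (k + 1) := mem_closedBallFinset_succ_of_adj ha heΓ
    have ha' := mem_closedBallFinset.1 ha
    have hb' := mem_closedBallFinset.1 hb
    refine ⟨a, b, rfl, heΓ, ha'.1, by omega, fun v hv hvo hve => heT ?_⟩
    rw [hT, Finset.mem_image]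
    refine ⟨v, Finset.mem_erase.2 ⟨hvo, ?_⟩, hve⟩
    have hmem : v ∈ s(a, b) := hve ▸ Sym2.mem_mk_left _ _
    rcases Sym2.mem_iff.1 hmem with rfl | rfl
    · exact closedBallFinset_mono (Nat.le_succ k) ha
    · exact hb
  have htwo : 1 < (Γ.touchingEdges (Γ.closedBallFinset o k) \ T).card := by
    have := Finset.le_card_sdiff T (Γ.touchingEdges (Γ.closedBallFinset o k))
    omega
  obtain ⟨e, he, f, hf, hef⟩ := Finset.one_lt_card.1 htwo
  obtain ⟨a, b, rfl, hab, ha, hd, hea⟩ := hend e he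
  obtain ⟨c, d, rfl, hcd, hc, hd', hfc⟩ := hend f hf
  obtain ⟨H, h1, h2, h3⟩ := hp.exists_subgraph_of_two_edges hab hcd ha hc hef
    fun v hv hvo => ⟨hea v hv hvo, hfc v hv hvo⟩
  exact ⟨H, h1, h2, by omega⟩

/-- In a graph of minimum degree at least three without short connected subgraphs of negative
Euler characteristic, balls double in size. -/
theorem two_mul_card_closedBallFinset_le (hdeg : ∀ v : V, 3 ≤ (Γ.neighborSet v).ncard) {k : ℕ}
    (hno : ¬ ∃ H : Γ.Subgraph, H.Connected ∧ H.verts.ncard < H.edgeSet.ncard ∧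
      H.edgeSet.ncard ≤ 4 * (k + 1)) :
    2 * (Γ.closedBallFinset o k).card ≤ (Γ.closedBallFinset o (k + 1)).card := by
  obtain ⟨p, hp⟩ := Γ.exists_isParentMap o
  have h1 : (Γ.touchingEdges (Γ.closedBallFinset o k)).card ≤
      (Γ.closedBallFinset o (k + 1)).card :=
    not_lt.1 fun h => hno (hp.exists_subgraph_of_card_lt h)
  have h2 := hp.card_innerEdges_add_le k
  have h3 := Γ.sum_ncard_neighborSet_le (Γ.closedBallFinset o k)
  have h4 := Finset.card_nsmul_le_sum (Γ.closedBallFinset o k) _ 3 fun v _ => hdeg v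
  rw [smul_eq_mul] at h4
  omega

theorem four_le_card_closedBallFinset_one (hdeg : ∀ v : V, 3 ≤ (Γ.neighborSet v).ncard) :
    4 ≤ (Γ.closedBallFinset o 1).card := by
  have hsub : insert o (Γ.neighborSet o) ⊆ ↑(Γ.closedBallFinset o 1) := by
    have ho : o ∈ Γ.closedBallFinset o 0 := mem_closedBallFinset.2 ⟨.refl _, by simp⟩
    rintro v (rfl | hv)
    · exact closedBallFinset_mono zero_le_one ho
    · exact mem_closedBallFinset_succ_of_adj ho hv
  have h := Set.ncard_le_ncard hsub (Finset.finite_toSet _)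
  rw [Set.ncard_insert_of_notMem (by simp) (Set.toFinite _), Set.ncard_coe_finset] at h
  have := hdeg o
  omega

theorem two_pow_le_card_closedBallFinset (hdeg : ∀ v : V, 3 ≤ (Γ.neighborSet v).ncard) {k : ℕ}
    (hno : ¬ ∃ H : Γ.Subgraph, H.Connected ∧ H.verts.ncard < H.edgeSet.ncard ∧
      H.edgeSet.ncard ≤ 4 * (k + 1)) :
    2 ^ (k + 2) ≤ (Γ.closedBallFinset o (k + 1)).card := by
  induction k with
  | zero => exact four_le_card_closedBallFinset_one hdeg
  | succ k ih =>
    have h1 := ih fun ⟨H, h1, h2, h3⟩ => hno ⟨H, h1, h2, by omega⟩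
    have h2 := two_mul_card_closedBallFinset_le (o := o) hdeg hno
    rw [pow_succ]
    omega

end Ball

end SimpleGraph


/-- Let `Γ` be a nonempty finite simple graph which has at least two vertices
and in which every vertex has degree at least 3, and let `V` denote the number of vertices of
`Γ`.  Then `Γ` contains a connected subgraph `H` with `|E(H)| > |V(H)|` (i.e. `χ(H) < 0`) and
with `|E(H)| ≤ 4·log₂ V`. -/
theorem exists_short_negative_subgraph_of_min_degree_three {V : Type*} [Fintype V]
    (Γ : SimpleGraph V) (hV : 2 ≤ Fintype.card V)
    (hdeg : ∀ v : V, 3 ≤ (Γ.neighborSet v).ncard) :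
    ∃ H : Γ.Subgraph, H.Connected ∧ H.verts.ncard < H.edgeSet.ncard ∧
      (H.edgeSet.ncard : ℝ) ≤ 4 * Real.logb 2 (Fintype.card V) := by
  classical
  have : Nonempty V := Fintype.card_pos_iff.1 (by omega)
  obtain ⟨o⟩ := this
  obtain ⟨k, hk⟩ : ∃ k, Nat.log 2 (Fintype.card V) = k + 1 :=
    ⟨_, (Nat.succ_pred_eq_of_pos (Nat.log_pos one_lt_two hV)).symm⟩
  obtain ⟨H, h1, h2, h3⟩ : ∃ H : Γ.Subgraph, H.Connected ∧
      H.verts.ncard < H.edgeSet.ncard ∧ H.edgeSet.ncard ≤ 4 * (k + 1) := by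
    by_contra hno
    have hlow := SimpleGraph.two_pow_le_card_closedBallFinset (o := o) hdeg hno
    have hup := Nat.lt_pow_succ_log_self one_lt_two (Fintype.card V)
    rw [hk] at hup
    exact absurd (hlow.trans (Finset.card_le_univ _)) (not_le.2 hup)
  refine ⟨H, h1, h2, ?_⟩
  have hlog := Real.natLog_le_logb (Fintype.card V) 2
  rw [hk] at hlog
  have h3' : (H.edgeSet.ncard : ℝ) ≤ 4 * ((k + 1 : ℕ) : ℝ) := by exact_mod_cast h3
  push_cast at hlog h3'
  linarith
end

section
/- Let Γ be a finite simple graph such that no connected component of Γ is acyclic and such that χ(Γ) = |V(Γ)| − |E(Γ)| < 0. Then Γ contains a connected subgraph H with |E(H)| > |V(H)| (i.e. χ(H) < 0) and with |E(H)| ≤ 4·log₂(2·|χ(Γ)|)·⌊|E(Γ)|/|χ(Γ)|⌋. -/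
namespace SimpleGraph

section

open scoped Classical
open Finset

variable {V : Type*} {G : SimpleGraph V}

/-- The edges of `G` with an endpoint in `D`. -/
noncomputable def touching [Fintype V] (G : SimpleGraph V) (D : Finset V) : Finset (Sym2 V) :=
  {e ∈ G.edgeFinset | ∃ v ∈ e, v ∈ D}

theorem touching_singleton [Fintype V] (v : V) : G.touching {v} = G.incidenceFinset v := by
  ext e
  simp [touching, incidenceSet]

theorem card_touching_image_range_le [Fintype V] {f : ℕ → V} (j : ℕ)
    (hdeg : ∀ i ≤ j, G.degree (f i) = 2) (hadj : ∀ i < j, G.Adj (f (i + 1)) (f i)) :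
    #(G.touching ((range (j + 1)).image f)) ≤ j + 2 := by
  induction j with
  | zero =>
    simp [touching_singleton, hdeg]
  | succ j ih =>
    have ih := ih (fun i hi => hdeg i (by omega)) (fun i hi => hadj i (by omega))
    have hsub : G.touching ((range (j + 1 + 1)).image f) ⊆
        G.touching ((range (j + 1)).image f) ∪
          (G.incidenceFinset (f (j + 1))).erase s(f (j + 1), f j) := by
      intro e he
      rw [mem_union, or_iff_not_imp_left]
      intro hne
      simp only [touching, mem_filter, mem_image, mem_range, not_and, not_exists] at he hne
      obtain ⟨he, v, hv, i, hi, rfl⟩ := he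
      have hij : i = j + 1 := by
        by_contra h
        exact hne he (f i) hv i (by omega) rfl
      subst hij
      rw [mem_erase, mem_incidenceFinset]
      refine ⟨?_, by simpa using he, hv⟩
      rintro rfl
      exact hne he (f j) (by simp) j (by omega) rfl
    have hcard : #((G.incidenceFinset (f (j + 1))).erase s(f (j + 1), f j)) = 1 := by
      rw [card_erase_of_mem, card_incidenceFinset_eq_degree, hdeg (j + 1) le_rfl]
      rw [mem_incidenceFinset]
      exact ⟨hadj j (by omega), by simp⟩
    have := (card_le_card hsub).trans (card_union_le _ _)
    omega

/-- A breadth-first spanning tree of `G`, given by a depth function and a parent map. -/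
structure BFSTree (G : SimpleGraph V) where
  root : V
  depth : V → ℕ
  parent : V → V
  depth_root : depth root = 0
  parent_root : parent root = root
  adj_parent : ∀ v, v ≠ root → G.Adj v (parent v)
  depth_parent : ∀ v, v ≠ root → depth (parent v) + 1 = depth v
  depth_le : ∀ u v, G.Adj u v → depth u ≤ depth v + 1

/-- A connected graph has a breadth-first spanning tree with any prescribed root. -/
theorem Connected.exists_bfsTree (hG : G.Connected) (r : V) : ∃ T : BFSTree G, T.root = r := by
  have key : ∀ v, v ≠ r → ∃ w, G.Adj v w ∧ G.dist w r + 1 = G.dist v r := by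
    intro v hv
    obtain ⟨p, hp⟩ := hG.exists_walk_length_eq_dist v r
    cases p with
    | nil => exact absurd rfl hv
    | cons h q =>
      rename_i w
      refine ⟨w, h, ?_⟩
      have h₁ := dist_le q
      have h₂ := hG.dist_triangle (u := v) (v := w) (w := r)
      rw [dist_eq_one_iff_adj.2 h] at h₂
      simp only [Walk.length_cons] at hp
      omega
  choose! p hp using key
  refine ⟨⟨r, fun v => G.dist v r, fun v => if v = r then r else p v, by simp, by simp, ?_, ?_, ?_⟩,
    rfl⟩
  · intro v hv
    simpa [hv] using (hp v hv).1
  · intro v hv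
    simpa [hv] using (hp v hv).2
  · intro u v h
    have h₂ := hG.dist_triangle (u := u) (v := v) (w := r)
    rw [dist_eq_one_iff_adj.2 h] at h₂
    omega

namespace BFSTree

variable (T : BFSTree G)

theorem eq_root_of_depth_eq_zero {v : V} (h : T.depth v = 0) : v = T.root := by
  by_contra hv
  have := T.depth_parent v hv
  omega

theorem depth_parent_eq (v : V) : T.depth (T.parent v) = T.depth v - 1 := by
  by_cases hv : v = T.root
  · subst hv
    simp [T.parent_root, T.depth_root]
  · have := T.depth_parent v hv
    omega

theorem depth_iterate_parent (i : ℕ) (v : V) : T.depth (T.parent^[i] v) = T.depth v - i := by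
  induction i with
  | zero => rfl
  | succ i ih =>
    rw [Function.iterate_succ_apply', depth_parent_eq, ih]
    omega

theorem injOn_mk_parent : Set.InjOn (fun v => s(v, T.parent v)) {v | v ≠ T.root} := by
  intro v hv w hw h
  rcases Sym2.eq_iff.1 h with h | h
  · exact h.1
  · have h₁ := T.depth_parent v hv
    have h₂ := T.depth_parent w hw
    rw [h.2] at h₁
    rw [← h.1] at h₂
    omega

/-- The ancestors of a vertex, including itself. -/
noncomputable def ancestors (v : V) : Finset V :=
  (range (T.depth v + 1)).image fun i => T.parent^[i] v

theorem self_mem_ancestors (v : V) : v ∈ T.ancestors v :=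
  mem_image.2 ⟨0, by simp, rfl⟩

theorem root_mem_ancestors (v : V) : T.root ∈ T.ancestors v :=
  mem_image.2 ⟨T.depth v, by simp,
    T.eq_root_of_depth_eq_zero (by rw [depth_iterate_parent, Nat.sub_self])⟩

theorem card_ancestors_le (v : V) : #(T.ancestors v) ≤ T.depth v + 1 :=
  card_image_le.trans (card_range _).le

theorem parent_mem_ancestors {u v : V} (h : u ∈ T.ancestors v) :
    T.parent u ∈ T.ancestors v := by
  obtain ⟨i, hi, rfl⟩ := mem_image.1 h
  rw [mem_range] at hi
  by_cases hi' : i = T.depth v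
  · have h₀ : T.parent^[i] v = T.root :=
      T.eq_root_of_depth_eq_zero (by rw [depth_iterate_parent, hi', Nat.sub_self])
    rw [h₀, T.parent_root]
    exact T.root_mem_ancestors v
  · exact mem_image.2 ⟨i + 1, mem_range.2 (by omega), Function.iterate_succ_apply' _ _ _⟩

/-- A set of vertices closed under taking parents spans, together with a set of non-tree edges,
a connected subgraph. -/
theorem exists_connected_subgraph {A : Finset V} (hroot : T.root ∈ A)
    (hA : ∀ v ∈ A, T.parent v ∈ A) {F : Finset (Sym2 V)} (hFG : ∀ e ∈ F, e ∈ G.edgeSet)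
    (hFA : ∀ e ∈ F, ∀ v ∈ e, v ∈ A)
    (hFT : ∀ e ∈ F, ∀ v, v ≠ T.root → e ≠ s(v, T.parent v)) :
    ∃ H : G.Subgraph, H.Connected ∧ H.verts.ncard = #A ∧ H.edgeSet.ncard + 1 = #A + #F := by
  let H : G.Subgraph :=
    { verts := A
      Adj := fun a b => s(a, b) ∈ F ∪ (A.erase T.root).image fun v => s(v, T.parent v)
      adj_sub := by
        intro a b h
        simp only [mem_union, mem_image, mem_erase] at h
        rcases h with h | ⟨v, hv, h⟩
        · exact hFG _ h
        · rw [← mem_edgeSet, ← h]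
          exact T.adj_parent v hv.1
      edge_vert := by
        intro a b h
        simp only [mem_union, mem_image, mem_erase] at h
        rcases h with h | ⟨v, hv, h⟩
        · exact hFA _ h a (by simp)
        · have ha : a ∈ s(v, T.parent v) := by rw [h]; simp
          rcases Sym2.mem_iff.1 ha with rfl | rfl
          · exact hv.2
          · exact hA v hv.2
      symm := ⟨fun a b h => by rwa [Sym2.eq_swap]⟩ }
  have hedge : H.edgeSet = ↑(F ∪ (A.erase T.root).image fun v => s(v, T.parent v)) := by
    ext e
    induction e with
    | _ a b => rfl
  refine ⟨H, ?_, Set.ncard_coe_finset A, ?_⟩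
  · rw [Subgraph.connected_iff', connected_iff_exists_forall_reachable]
    refine ⟨⟨T.root, hroot⟩, ?_⟩
    suffices h : ∀ n v (hv : v ∈ A), T.depth v = n →
        H.coe.Reachable ⟨T.root, hroot⟩ ⟨v, hv⟩ from fun v => h _ v.1 v.2 rfl
    intro n
    induction n with
    | zero =>
      intro v hv h
      obtain rfl := T.eq_root_of_depth_eq_zero h
      exact Reachable.refl _
    | succ n ih =>
      intro v hv h
      have hne : v ≠ T.root := by
        rintro rfl
        rw [T.depth_root] at h
        omega
      refine (ih (T.parent v) (hA v hv) (by rw [depth_parent_eq, h]; rfl)).trans (Adj.reachable ?_)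
      refine Adj.symm (?_ : H.Adj v (T.parent v))
      exact mem_union_right _ (mem_image.2 ⟨v, mem_erase.2 ⟨hne, hv⟩, rfl⟩)
  · rw [hedge, Set.ncard_coe_finset, card_union_of_disjoint, card_image_of_injOn, add_assoc,
      card_erase_add_one hroot, add_comm]
    · exact T.injOn_mk_parent.mono fun v hv => by simpa using (mem_erase.1 hv).1
    · rw [Finset.disjoint_left]
      intro e he he'
      obtain ⟨v, hv, rfl⟩ := mem_image.1 he'
      exact hFT _ he v (mem_erase.1 hv).1 rfl

variable [Fintype V]

/-- The edges outside the tree. -/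
noncomputable def extra : Finset (Sym2 V) :=
  {e ∈ G.edgeFinset | ∀ v, v ≠ T.root → e ≠ s(v, T.parent v)}

/-- The edges outside the tree with an endpoint at depth less than `R`. -/
noncomputable def extraBelow (R : ℕ) : Finset (Sym2 V) :=
  {e ∈ T.extra | ∃ v ∈ e, T.depth v < R}

/-- The number of edges outside the tree at a vertex. -/
noncomputable def extraDegree (v : V) : ℕ := #{e ∈ T.extra | v ∈ e}

/-- The children of a vertex. -/
noncomputable def children (v : V) : Finset V := {w | w ≠ T.root ∧ T.parent w = v}

/-- The vertices at depth at most `R`. -/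
noncomputable def level (R : ℕ) : Finset V := {v | T.depth v ≤ R}

/-- The total excess of the degrees over two among the vertices at depth at most `R`. -/
noncomputable def excess (R : ℕ) : ℕ := ∑ v ∈ T.level R, (G.degree v - 2)

theorem extraBelow_mono : Monotone T.extraBelow := by
  intro R S h e he
  simp only [extraBelow, mem_filter] at he ⊢
  obtain ⟨he, v, hv, hlt⟩ := he
  exact ⟨he, v, hv, by omega⟩

theorem degree_le (v : V) :
    G.degree v ≤ #(T.children v) + (if v = T.root then 0 else 1) + T.extraDegree v := by
  have hsub : G.neighborFinset v ⊆ T.children v ∪ (if v = T.root then ∅ else {T.parent v}) ∪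
      ({w | s(v, w) ∈ T.extra} : Finset V) := by
    intro w hw
    rw [mem_neighborFinset] at hw
    by_cases hx : s(v, w) ∈ T.extra
    · simp [hx]
    · simp only [extra, mem_filter, mem_edgeFinset, mem_edgeSet, hw, true_and, not_forall,
        not_not] at hx
      obtain ⟨u, hu, he⟩ := hx
      rcases Sym2.eq_iff.1 he with h | h
      · obtain ⟨rfl, rfl⟩ := h
        simp [hu]
      · obtain ⟨rfl, rfl⟩ := h
        simp [children, hu]
  have hext : #({w | s(v, w) ∈ T.extra} : Finset V) ≤ T.extraDegree v := by
    refine card_le_card_of_injOn (fun w => s(v, w)) ?_ ?_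
    · intro w hw
      simpa using hw
    · intro a _ b _ h
      exact Sym2.congr_right.1 h
  rw [← card_neighborFinset_eq_degree]
  refine (card_le_card hsub).trans ((card_union_le _ _).trans ?_)
  refine add_le_add ((card_union_le _ _).trans (add_le_add le_rfl ?_)) hext
  split_ifs <;> simp

theorem root_mem_level (R : ℕ) : T.root ∈ T.level R := by
  simp [level, T.depth_root]

theorem sum_card_children (R : ℕ) :
    ∑ v ∈ T.level R, #(T.children v) + 1 = #(T.level (R + 1)) := by
  rw [← card_erase_add_one (T.root_mem_level (R + 1)),
    card_eq_sum_card_fiberwise (f := T.parent) (t := T.level R)]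
  · congr 1
    refine sum_congr rfl fun v hv => congrArg card ?_
    ext w
    simp only [children, level, mem_filter, mem_univ, true_and, mem_erase] at hv ⊢
    constructor
    · rintro ⟨h, rfl⟩
      exact ⟨⟨h, by have := T.depth_parent w h; omega⟩, rfl⟩
    · rintro ⟨⟨h, -⟩, h'⟩
      exact ⟨h, h'⟩
  · intro w hw
    simp only [level, coe_erase, coe_filter, mem_univ, true_and, Set.mem_sdiff, Set.mem_ofPred_eq,
      Set.mem_singleton_iff] at hw ⊢
    have := T.depth_parent w hw.2
    omega

theorem sum_extraDegree_le (R : ℕ) :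
    ∑ v with T.depth v < R, T.extraDegree v ≤ 2 * #(T.extraBelow R) := by
  have h : ∀ v ∈ ({v | T.depth v < R} : Finset V),
      T.extraDegree v = ∑ e ∈ T.extraBelow R, if v ∈ e then 1 else 0 := by
    intro v hv
    rw [← card_filter, extraDegree, extraBelow, filter_filter]
    congr 1
    ext e
    simp only [mem_filter, mem_univ, true_and] at hv ⊢
    exact ⟨fun h => ⟨h.1, ⟨v, h.2, hv⟩, h.2⟩, fun h => ⟨h.1, h.2.2⟩⟩
  rw [sum_congr rfl h, sum_comm, mul_comm, ← smul_eq_mul]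
  refine sum_le_card_nsmul _ _ _ fun e _ => ?_
  rw [← card_filter]
  induction e with
  | _ a b =>
    refine (card_le_card (t := {a, b}) ?_).trans card_le_two
    intro v hv
    simpa using (mem_filter.1 hv).2

theorem excess_add_le (hdeg : ∀ v, 2 ≤ G.degree v) (R : ℕ) :
    T.excess R + 2 + #(T.level R) ≤ #(T.level (R + 1)) + ∑ v ∈ T.level R, T.extraDegree v := by
  have h₁ : ∑ v ∈ T.level R, G.degree v = T.excess R + 2 * #(T.level R) := by
    rw [excess, mul_comm, ← smul_eq_mul, ← sum_const, ← sum_add_distrib]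
    exact sum_congr rfl fun v _ => by have := hdeg v; omega
  have h₂ := sum_le_sum fun v (_ : v ∈ T.level R) => T.degree_le v
  have h₃ : ∑ v ∈ T.level R, (if v = T.root then 0 else 1) + 1 = #(T.level R) := by
    rw [← card_erase_add_one (T.root_mem_level R), ← filter_ne', card_filter]
    congr 1
    exact sum_congr rfl fun v _ => by by_cases h : v = T.root <;> simp [h]
  rw [sum_add_distrib, sum_add_distrib] at h₂
  have h₄ := T.sum_card_children R
  omega

theorem exists_descendant {m : ℕ} (hm : 1 ≤ m) (hdeg : ∀ v, 2 ≤ G.degree v)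
    (hD : ∀ D : Finset V, D.Nonempty → (m + 1) * #D < m * #(G.touching D))
    {R : ℕ} {u : V} (hu : T.depth u = R + 1) :
    ∃ v, ∃ i < m, T.parent^[i] v = u ∧ T.depth v = R + 1 + i ∧
      (3 ≤ G.degree v ∨ (i + 1 < m ∧ 1 ≤ T.extraDegree v)) := by
  by_contra! hno
  have hchild : ∀ v, (T.children v).Nonempty → ∃ w, w ≠ T.root ∧ T.parent w = v := by
    rintro v ⟨w, hw⟩
    exact ⟨w, by simpa [children] using hw⟩
  choose! c hc using hchild
  have hc' : ∀ v i, i + 1 < m → T.parent^[i] v = u → T.depth v = R + 1 + i →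
      c v ≠ T.root ∧ T.parent (c v) = v := by
    intro v i hi hpv hdv
    refine hc v (card_pos.1 ?_)
    have h₁ := hno v i (by omega) hpv hdv
    have h₂ := h₁.2 hi
    have h₃ := T.degree_le v
    have h₄ := hdeg v
    split_ifs at h₃ <;> omega
  have hf : ∀ i < m, T.parent^[i] (c^[i] u) = u ∧ T.depth (c^[i] u) = R + 1 + i := by
    intro i
    induction i with
    | zero => exact fun _ => ⟨rfl, hu⟩
    | succ i ih =>
      intro hi
      obtain ⟨h₁, h₂⟩ := ih (by omega)
      obtain ⟨h₃, h₄⟩ := hc' _ i hi h₁ h₂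
      have h₅ := T.depth_parent _ h₃
      rw [Function.iterate_succ_apply' c]
      rw [h₄] at h₅
      exact ⟨by rw [Function.iterate_succ_apply, h₄, h₁], by omega⟩
  have hcard : #((range (m - 1 + 1)).image fun i => c^[i] u) = m := by
    rw [card_image_of_injOn, card_range]
    · omega
    · intro i hi j hj hij
      simp only [coe_range, Set.mem_Iio] at hi hj
      have h₁ := (hf i (by omega)).2
      have h₂ := (hf j (by omega)).2
      rw [show c^[i] u = c^[j] u from hij] at h₁
      omega
  have htouch := card_touching_image_range_le (G := G) (f := fun i => c^[i] u) (m - 1)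
    (fun i hi => by
      obtain ⟨h₁, h₂⟩ := hf i (by omega)
      have h₃ := (hno _ i (by omega) h₁ h₂).1
      have h₄ := hdeg (c^[i] u)
      omega)
    (fun i hi => by
      obtain ⟨h₁, h₂⟩ := hf i (by omega)
      obtain ⟨h₃, h₄⟩ := hc' _ i (by omega) h₁ h₂
      have h₅ := T.adj_parent _ h₃
      rw [h₄] at h₅
      simpa only [Function.iterate_succ_apply'] using h₅)
  have h := hD ((range (m - 1 + 1)).image fun i => c^[i] u) (card_pos.1 (by omega))
  rw [hcard] at h
  have := h.trans_le (Nat.mul_le_mul_left m htouch)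
  rw [show m - 1 + 2 = m + 1 by omega, mul_comm] at this
  exact lt_irrefl _ this

/-- Going `m` levels deeper doubles the excess, up to the contribution of non-tree edges. -/
theorem two_mul_excess_add_two_le {m : ℕ} (hm : 1 ≤ m) (hdeg : ∀ v, 2 ≤ G.degree v)
    (hD : ∀ D : Finset V, D.Nonempty → (m + 1) * #D < m * #(G.touching D)) (R : ℕ) :
    2 * T.excess R + 2 ≤ T.excess (R + m) + 2 * #(T.extraBelow (R + m)) := by
  have hdesc : ∀ u, T.depth u = R + 1 → ∃ v, ∃ i < m, T.parent^[i] v = u ∧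
      T.depth v = R + 1 + i ∧ (3 ≤ G.degree v ∨ (i + 1 < m ∧ 1 ≤ T.extraDegree v)) :=
    fun u hu => T.exists_descendant hm hdeg hD hu
  choose! φ i hi hφ hdepth hcase using hdesc
  set S : Finset V := {v | T.depth v = R + 1} with hS
  set B : Finset V := {v | R < T.depth v ∧ T.depth v ≤ R + m} with hB
  have hlevel : #(T.level (R + 1)) = #(T.level R) + #S := by
    rw [← card_union_of_disjoint]
    · congr 1
      ext v
      simp only [level, hS, mem_filter, mem_univ, true_and, mem_union]
      omega
    · rw [Finset.disjoint_left]
      intro v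
      simp only [level, hS, mem_filter, mem_univ, true_and]
      omega
  have hexcess : T.excess (R + m) = T.excess R + ∑ v ∈ B, (G.degree v - 2) := by
    rw [excess, excess, ← sum_union]
    · congr 1
      ext v
      simp only [level, hB, mem_filter, mem_univ, true_and, mem_union]
      omega
    · rw [Finset.disjoint_left]
      intro v
      simp only [level, hB, mem_filter, mem_univ, true_and]
      omega
  have hextra : ∑ v ∈ T.level R, T.extraDegree v +
      ∑ v ∈ B, (if T.depth v < R + m then T.extraDegree v else 0) ≤
        2 * #(T.extraBelow (R + m)) := by
    refine le_trans (le_of_eq ?_) (T.sum_extraDegree_le (R + m))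
    rw [← sum_filter, ← sum_union]
    · congr 1
      ext v
      simp only [level, hB, mem_filter, mem_univ, true_and, mem_union]
      omega
    · rw [Finset.disjoint_left]
      intro v
      simp only [level, hB, mem_filter, mem_univ, true_and]
      omega
  have hcardS : #S ≤ ∑ v ∈ B, (G.degree v - 2) +
      ∑ v ∈ B, (if T.depth v < R + m then T.extraDegree v else 0) := by
    rw [← sum_add_distrib]
    have hinj : Set.InjOn φ S := by
      intro u hu w hw h
      simp only [hS, coe_filter, mem_univ, true_and, Set.mem_ofPred_eq] at hu hw
      have h₁ := hdepth u hu
      have h₂ := hdepth w hw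
      rw [h] at h₁
      have h₃ : i u = i w := by omega
      rw [← hφ u hu, ← hφ w hw, h, h₃]
    rw [← card_image_of_injOn hinj, card_eq_sum_ones]
    have hsub : S.image φ ⊆ B := by
      intro v hv
      simp only [hS, mem_image, mem_filter, mem_univ, true_and] at hv
      obtain ⟨u, hu, rfl⟩ := hv
      have h₁ := hdepth u hu
      have h₂ := hi u hu
      simp only [hB, mem_filter, mem_univ, true_and]
      omega
    refine le_trans (sum_le_sum fun v hv => ?_) (sum_le_sum_of_subset hsub)
    simp only [hS, mem_image, mem_filter, mem_univ, true_and] at hv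
    obtain ⟨u, hu, rfl⟩ := hv
    have h₁ := hdepth u hu
    rcases hcase u hu with h | ⟨h, h'⟩
    · omega
    · rw [if_pos (by omega)]
      omega
  have := T.excess_add_le hdeg R
  omega

theorem exists_closed_of_mem_extraBelow {R : ℕ} {e : Sym2 V} (he : e ∈ T.extraBelow R) :
    ∃ A : Finset V, T.root ∈ A ∧ (∀ v ∈ A, T.parent v ∈ A) ∧ (∀ v ∈ e, v ∈ A) ∧ #A ≤ 2 * R := by
  obtain ⟨he, x, hx, hxR⟩ := mem_filter.1 he
  obtain ⟨y, rfl⟩ := Sym2.mem_iff_exists.1 hx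
  have hadj : G.Adj y x := by simpa using (mem_edgeFinset.1 (mem_filter.1 he).1).symm
  refine ⟨T.ancestors x ∪ T.ancestors y, mem_union_left _ (T.root_mem_ancestors x), ?_, ?_, ?_⟩
  · intro v hv
    rcases mem_union.1 hv with h | h
    · exact mem_union_left _ (T.parent_mem_ancestors h)
    · exact mem_union_right _ (T.parent_mem_ancestors h)
  · intro v hv
    rcases Sym2.mem_iff.1 hv with rfl | rfl
    · exact mem_union_left _ (T.self_mem_ancestors _)
    · exact mem_union_right _ (T.self_mem_ancestors _)
  · have h₁ := card_union_add_card_inter (T.ancestors x) (T.ancestors y)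
    have h₂ : 0 < #(T.ancestors x ∩ T.ancestors y) :=
      card_pos.2 ⟨T.root, mem_inter.2 ⟨T.root_mem_ancestors x, T.root_mem_ancestors y⟩⟩
    have h₃ := T.card_ancestors_le x
    have h₄ := T.card_ancestors_le y
    have h₅ := T.depth_le y x hadj
    omega

theorem exists_subgraph_of_mem_extraBelow {R S : ℕ} {e f : Sym2 V} (he : e ∈ T.extraBelow R)
    (hf : f ∈ T.extraBelow S) (hef : e ≠ f) :
    ∃ H : G.Subgraph, H.Connected ∧ H.verts.ncard < H.edgeSet.ncard ∧
      H.edgeSet.ncard ≤ 2 * R + 2 * S := by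
  obtain ⟨A, hA, hAp, heA, hAR⟩ := T.exists_closed_of_mem_extraBelow he
  obtain ⟨B, hB, hBp, hfB, hBS⟩ := T.exists_closed_of_mem_extraBelow hf
  have he' := mem_filter.1 (mem_filter.1 he).1
  have hf' := mem_filter.1 (mem_filter.1 hf).1
  obtain ⟨H, hH, hv, hE⟩ := T.exists_connected_subgraph (A := A ∪ B) (F := {e, f})
    (mem_union_left _ hA)
    (fun v hv => (mem_union.1 hv).elim (fun h => mem_union_left _ (hAp v h))
      fun h => mem_union_right _ (hBp v h))
    (by simpa using ⟨mem_edgeFinset.1 he'.1, mem_edgeFinset.1 hf'.1⟩)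
    (by
      simp only [mem_insert, mem_singleton, forall_eq_or_imp, forall_eq]
      exact ⟨fun v hv => mem_union_left _ (heA v hv), fun v hv => mem_union_right _ (hfB v hv)⟩)
    (by
      simp only [mem_insert, mem_singleton, forall_eq_or_imp, forall_eq]
      exact ⟨he'.2, hf'.2⟩)
  rw [card_pair hef] at hE
  have h₁ := card_union_add_card_inter A B
  have h₂ : 0 < #(A ∩ B) := card_pos.2 ⟨T.root, mem_inter.2 ⟨hA, hB⟩⟩
  exact ⟨H, hH, by omega, by omega⟩

/-- If the excess never exceeds `2 * k`, two non-tree edges occur close to the root. -/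
theorem exists_subgraph_of_excess_le {m k : ℕ} (hm : 1 ≤ m) (hk : 2 ≤ k)
    (hdeg : ∀ v, 2 ≤ G.degree v)
    (hD : ∀ D : Finset V, D.Nonempty → (m + 1) * #D < m * #(G.touching D))
    (hroot : 3 ≤ G.degree T.root) (hexcess : ∀ R, T.excess R ≤ 2 * k) :
    ∃ H : G.Subgraph, H.Connected ∧ H.verts.ncard < H.edgeSet.ncard ∧
      H.edgeSet.ncard ≤ 4 * Nat.log 2 (2 * k) * m := by
  have hstart : 1 ≤ T.excess 0 := by
    have := single_le_sum (f := fun v => G.degree v - 2) (fun _ _ => Nat.zero_le _)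
      (T.root_mem_level 0)
    rw [excess]
    omega
  have hgrow := T.two_mul_excess_add_two_le hm hdeg hD
  have hlt : 2 * k < 2 ^ (Nat.log 2 (2 * k) + 1) := Nat.lt_pow_succ_log_self (by omega) _
  have hL : 2 ≤ Nat.log 2 (2 * k) := Nat.le_log_of_pow_le (by omega) (by omega)
  generalize Nat.log 2 (2 * k) = L at hlt hL
  obtain h0 | ⟨e, he⟩ := (T.extraBelow m).eq_empty_or_nonempty
  · have hiter : ∀ j, #(T.extraBelow ((j + 1) * m)) ≤ 1 → 2 ^ (j + 2) ≤ T.excess ((j + 1) * m) := by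
      intro j
      induction j with
      | zero =>
        intro _
        have := hgrow 0
        simp only [zero_add, h0, card_empty, one_mul] at this ⊢
        omega
      | succ j ih =>
        intro h
        have h₁ := ih ((card_le_card (T.extraBelow_mono
          (Nat.mul_le_mul_right m (Nat.le_succ _)))).trans h)
        have h₂ := hgrow ((j + 1) * m)
        rw [← Nat.succ_mul] at h₂
        rw [pow_succ]
        simp only [Nat.succ_eq_add_one] at h₂
        omega
    have hcard : 1 < #(T.extraBelow (L * m)) := by
      by_contra! h
      have h₁ := hiter (L - 1) (by rwa [Nat.sub_add_cancel (by omega)])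
      rw [Nat.sub_add_cancel (by omega), show L - 1 + 2 = L + 1 by omega] at h₁
      have := hexcess (L * m)
      omega
    obtain ⟨e, he, f, hf, hef⟩ := one_lt_card.1 hcard
    obtain ⟨H, hH, hv, hE⟩ := T.exists_subgraph_of_mem_extraBelow he hf hef
    exact ⟨H, hH, hv, hE.trans (le_of_eq (by ring))⟩
  · have hiter : ∀ j, #(T.extraBelow (j * m)) ≤ 1 → 2 ^ j ≤ T.excess (j * m) := by
      intro j
      induction j with
      | zero =>
        intro _
        simpa using hstart
      | succ j ih =>
        intro h
        have h₁ := ih ((card_le_card (T.extraBelow_mono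
          (Nat.mul_le_mul_right m (Nat.le_succ _)))).trans h)
        have h₂ := hgrow (j * m)
        rw [← Nat.succ_mul] at h₂
        rw [pow_succ]
        simp only [Nat.succ_eq_add_one] at h₂
        omega
    have hcard : 1 < #(T.extraBelow ((L + 1) * m)) := by
      by_contra! h
      have h₁ := hiter (L + 1) h
      have := hexcess ((L + 1) * m)
      omega
    obtain ⟨f, hf, hef⟩ := exists_mem_ne hcard e
    obtain ⟨H, hH, hv, hE⟩ := T.exists_subgraph_of_mem_extraBelow he hf hef.symm
    refine ⟨H, hH, hv, hE.trans ?_⟩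
    nlinarith [Nat.mul_le_mul_right m hL]

end BFSTree

/-- The edges of `G` with both endpoints in `D`. -/
noncomputable def inner [Fintype V] (G : SimpleGraph V) (D : Finset V) : Finset (Sym2 V) :=
  {e ∈ G.edgeFinset | ∀ v ∈ e, v ∈ D}

theorem card_inner_compl_add_card_touching [Fintype V] (D : Finset V) :
    #(G.inner Dᶜ) + #(G.touching D) = #G.edgeFinset := by
  rw [← card_filter_add_card_filter_not (s := G.edgeFinset) fun e => ∀ v ∈ e, v ∈ Dᶜ]
  simp [inner, touching]

/-- If no edge leaves `D`, every edge lies inside `D` or inside its complement. -/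
theorem card_inner_add_card_inner_compl [Fintype V] {D : Finset V}
    (hD : ∀ u v, G.Adj u v → u ∈ D → v ∈ D) :
    #(G.inner D) + #(G.inner Dᶜ) = #G.edgeFinset := by
  rw [← G.card_inner_compl_add_card_touching D, add_comm]
  congr 2
  ext e
  induction e with
  | _ a b =>
    simp only [inner, touching, mem_filter, mem_edgeFinset, mem_edgeSet, Sym2.mem_iff,
      forall_eq_or_imp, forall_eq, exists_eq_or_imp, exists_eq_left]
    exact and_congr_right fun h =>
      ⟨fun h' => .inl h'.1, fun h' => h'.elim (fun ha => ⟨ha, hD a b h ha⟩)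
        fun hb => ⟨hD b a h.symm hb, hb⟩⟩

/-- A graph that is minimal among its induced subgraphs with `m * |E| > (m + 1) * |V|` has a
small connected subgraph of negative Euler characteristic. -/
theorem exists_subgraph_of_minimal [Fintype V] {m k : ℕ}
    (hk : #G.edgeFinset = Fintype.card V + k)
    (hbig : (m + 1) * Fintype.card V < m * #G.edgeFinset)
    (hmin : ∀ D : Finset V, D ≠ univ → m * #(G.inner D) ≤ (m + 1) * #D) :
    ∃ H : G.Subgraph, H.Connected ∧ H.verts.ncard < H.edgeSet.ncard ∧
      H.edgeSet.ncard ≤ 4 * Nat.log 2 (2 * k) * m := by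
  have hm : 1 ≤ m := by
    by_contra h
    simp [show m = 0 by omega] at hbig
  have hk0 : 1 ≤ k := by
    by_contra h
    rw [hk, show k = 0 by omega] at hbig
    nlinarith
  have hD : ∀ D : Finset V, D.Nonempty → (m + 1) * #D < m * #(G.touching D) := by
    intro D hne
    have h₁ := hmin Dᶜ (by simpa [compl_eq_univ_iff] using hne.ne_empty)
    have h₂ := G.card_inner_compl_add_card_touching D
    have h₃ := D.card_add_card_compl
    rw [← h₂, ← h₃] at hbig
    linarith
  have hdeg : ∀ v, 2 ≤ G.degree v := by
    intro v
    have h := hD {v} (singleton_nonempty v)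
    rw [touching_singleton, card_incidenceFinset_eq_degree, card_singleton] at h
    by_contra! h'
    have : m * G.degree v ≤ m * 1 := Nat.mul_le_mul_left m (by omega)
    omega
  have hsum : ∑ v, (G.degree v - 2) = 2 * k := by
    have h₁ : ∑ v, G.degree v = ∑ v, (G.degree v - 2) + 2 * Fintype.card V := by
      rw [mul_comm, ← smul_eq_mul, ← card_univ, ← sum_const, ← sum_add_distrib]
      exact sum_congr rfl fun v _ => by have := hdeg v; omega
    rw [sum_degrees_eq_twice_card_edges] at h₁
    omega
  obtain ⟨r, hr⟩ : ∃ r, 3 ≤ G.degree r := by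
    by_contra! h
    rw [sum_eq_zero fun v _ => by have := h v; omega] at hsum
    omega
  have hconn : G.Connected := by
    rw [connected_iff_exists_forall_reachable]
    refine ⟨r, fun w => ?_⟩
    by_contra hw
    set A : Finset V := {v | G.Reachable r v} with hA
    have h₁ := hmin A fun h => by
      have : w ∈ A := h ▸ mem_univ w
      exact hw (by simpa [hA] using this)
    have h₂ := hmin Aᶜ fun h => by
      have : r ∈ Aᶜ := h ▸ mem_univ r
      simp [hA] at this
    have h₃ := card_inner_add_card_inner_compl (G := G) (D := A) fun u v huv hu => by
      simp only [hA, mem_filter, mem_univ, true_and] at hu ⊢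
      exact hu.trans huv.reachable
    have h₄ := A.card_add_card_compl
    rw [← h₃, ← h₄] at hbig
    linarith
  by_cases hk2 : 2 ≤ k
  · obtain ⟨T, rfl⟩ := hconn.exists_bfsTree r
    exact T.exists_subgraph_of_excess_le hm hk2 hdeg hD hr fun R =>
      (sum_le_sum_of_subset (subset_univ _)).trans hsum.le
  · obtain rfl : k = 1 := by omega
    have hE : (⊤ : G.Subgraph).edgeSet.ncard = #G.edgeFinset := by
      rw [Subgraph.edgeSet_top, ← coe_edgeFinset, Set.ncard_coe_finset]
    refine ⟨⊤, Subgraph.connected_iff'.2 (Subgraph.topIso.connected_iff.2 hconn), ?_, ?_⟩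
    · rw [hE, Subgraph.verts_top, Set.ncard_univ, Nat.card_eq_fintype_card]
      omega
    · rw [hE, hk, mul_comm 2 1, Nat.log_mul_base one_lt_two one_ne_zero, Nat.log_one_right]
      rw [hk] at hbig
      nlinarith
theorem inner_univ [Fintype V] : G.inner univ = G.edgeFinset := by
  simp [inner]

theorem card_inner_induce [Fintype V] (S : Set V) [Fintype S] (D : Finset S) :
    #((G.induce S).inner D) = #(G.inner (D.map (Function.Embedding.subtype _))) := by
  rw [← card_image_of_injective _ (Sym2.map.injective Subtype.val_injective)]
  congr 1
  ext e
  induction e with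
  | _ a b =>
    simp only [inner, mem_image, mem_filter, mem_edgeFinset, mem_map,
      Function.Embedding.subtype_apply]
    constructor
    · rintro ⟨f, ⟨hf, hfD⟩, hfe⟩
      induction f with
      | _ c d =>
        rw [← hfe]
        simp only [Sym2.map_mk, mem_edgeSet, Sym2.mem_iff, forall_eq_or_imp, forall_eq] at hf hfD ⊢
        exact ⟨hf, ⟨c, hfD.1, rfl⟩, ⟨d, hfD.2, rfl⟩⟩
    · rintro ⟨hab, h⟩
      obtain ⟨c, hc, rfl⟩ := h a (by simp)
      obtain ⟨d, hd, rfl⟩ := h b (by simp)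
      refine ⟨s(c, d), ⟨hab, ?_⟩, rfl⟩
      simpa using ⟨hc, hd⟩

theorem card_edgeFinset_induce [Fintype V] (S : Finset V)
    [Fintype (G.induce (S : Set V)).edgeSet] :
    #(G.induce (S : Set V)).edgeFinset = #(G.inner S) := by
  have h : (G.induce (S : Set V)).edgeFinset = (G.induce (S : Set V)).inner univ := by
    ext e
    simp [inner]
  rw [h, card_inner_induce]
  congr 2
  ext v
  simp

/-- A connected component containing a cycle has at least as many edges as vertices. -/
theorem card_le_card_inner_of_isCycle [Fintype V] {w : V} {p : G.Walk w w} (hp : p.IsCycle)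
    {C : Finset V} (hC : ∀ v, v ∈ C ↔ G.Reachable w v) : #C ≤ #(G.inner C) := by
  have hconn : (G.induce (C : Set V)).Connected := by
    have hsupp : (C : Set V) = (G.connectedComponentMk w).supp := by
      ext v
      simp only [mem_coe, hC, ConnectedComponent.mem_supp_iff, ConnectedComponent.eq]
      exact reachable_comm
    rw [hsupp]
    exact (G.connectedComponentMk w).connected_toSimpleGraph
  have hcyc : ¬ (G.induce (C : Set V)).IsAcyclic := by
    intro h
    have hsup : ∀ v ∈ p.support, v ∈ (C : Set V) := fun v hv =>
      (hC v).2 ⟨p.takeUntil v hv⟩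
    refine h (p.induce _ hsup) ?_
    rwa [← Walk.isCycle_map_iff_of_injective (f := (Embedding.induce (C : Set V)).toHom)
      Subtype.val_injective, Walk.map_induce]
  have h₁ := hconn.card_vert_le_card_edgeSet_add_one
  have h₂ : ¬ (Nat.card (G.induce (C : Set V)).edgeSet + 1 = Nat.card (C : Set V)) := fun h =>
    hcyc (isTree_iff_connected_and_card.2 ⟨hconn, h⟩).isAcyclic
  have h₃ : Nat.card (G.induce (C : Set V)).edgeSet = #(G.inner C) := by
    rw [← card_edgeFinset_induce, Nat.card_eq_fintype_card, edgeFinset_card]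
  have h₄ : Nat.card (C : Set V) = #C := by simp
  omega

/-- In a graph without acyclic components, passing to an induced subgraph does not decrease the
Euler characteristic. -/
theorem card_inner_add_card_le [Fintype V]
    (hcyc : ∀ v : V, ∃ w : V, G.Reachable v w ∧ ∃ p : G.Walk w w, p.IsCycle) (S : Finset V) :
    #(G.inner S) + Fintype.card V ≤ #G.edgeFinset + #S := by
  induction hn : #Sᶜ using Nat.strong_induction_on generalizing S with
  | _ n ih =>
  subst hn
  by_cases hS : S = univ
  · simp [hS, inner_univ]
  by_cases hout : ∃ u ∈ S, ∃ v ∉ S, G.Adj u v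
  · obtain ⟨u, hu, v, hv, huv⟩ := hout
    have h₁ := ih _ (card_lt_card (compl_ssubset_compl.2 (ssubset_insert hv))) (insert v S) rfl
    have h₂ : insert s(u, v) (G.inner S) ⊆ G.inner (insert v S) := by
      intro e he
      rcases mem_insert.1 he with rfl | he
      · simp [inner, huv, hu]
      · simp only [inner, mem_filter] at he ⊢
        exact ⟨he.1, fun x hx => mem_insert_of_mem (he.2 x hx)⟩
    have h₃ := card_le_card h₂
    rw [card_insert_of_notMem (by simp [inner, hv])] at h₃
    rw [card_insert_of_notMem hv] at h₁
    omega
  · push Not at hout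
    obtain ⟨v, hv⟩ : ∃ v, v ∉ S := by
      by_contra! h
      exact hS (eq_univ_of_forall h)
    obtain ⟨w, hvw, p, hp⟩ := hcyc v
    set C : Finset V := {x | G.Reachable w x} with hC
    have hdisj : Disjoint S C := by
      have hclosed : ∀ x y, G.Reachable x y → x ∈ S → y ∈ S := by
        rintro x y ⟨q⟩
        induction q with
        | nil => exact id
        | cons h q ih => exact fun hx => ih (by_contra fun hy => hout _ hx _ hy h)
      rw [Finset.disjoint_left]
      intro x hx hxC
      exact hv (hclosed x v ((by simpa [hC] using hxC : G.Reachable w x).symm.trans hvw.symm) hx)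
    have hvC : v ∈ C := by simpa [hC] using hvw.symm
    have h₁ := ih _ (card_lt_card (compl_ssubset_compl.2
      ⟨subset_union_left, fun h => hv (h (mem_union_right _ hvC))⟩)) (S ∪ C) rfl
    have h₂ := card_le_card_inner_of_isCycle hp (C := C) (by simp [hC])
    have h₃ : G.inner S ∪ G.inner C ⊆ G.inner (S ∪ C) := by
      intro e he
      simp only [inner, mem_union, mem_filter] at he ⊢
      rcases he with he | he
      · exact ⟨he.1, fun x hx => .inl (he.2 x hx)⟩
      · exact ⟨he.1, fun x hx => .inr (he.2 x hx)⟩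
    have h₄ : Disjoint (G.inner S) (G.inner C) := by
      rw [Finset.disjoint_left]
      intro e he he'
      simp only [inner, mem_filter] at he he'
      induction e with
      | _ a b =>
        exact Finset.disjoint_left.1 hdisj (he.2 a (by simp)) (he'.2 a (by simp))
    have h₅ := card_le_card h₃
    rw [card_union_of_disjoint h₄] at h₅
    rw [card_union_of_disjoint hdisj] at h₁
    omega

/-- The integral form of the bound, with the ratio `|E| / |χ|` bounded by `m`. -/
theorem exists_short_subgraph [Fintype V]
    (hcyc : ∀ v : V, ∃ w : V, G.Reachable v w ∧ ∃ p : G.Walk w w, p.IsCycle) {m k : ℕ}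
    (hk : #G.edgeFinset = Fintype.card V + k)
    (hm : (m + 1) * Fintype.card V < m * #G.edgeFinset) :
    ∃ H : G.Subgraph, H.Connected ∧ H.verts.ncard < H.edgeSet.ncard ∧
      H.edgeSet.ncard ≤ 4 * Nat.log 2 (2 * k) * m := by
  obtain ⟨S, hS, hSmin⟩ := exists_min_image
    ({S | (m + 1) * #S < m * #(G.inner S)} : Finset (Finset V)) card
    ⟨univ, by simpa [inner_univ] using hm⟩
  simp only [mem_filter, mem_univ, true_and] at hS hSmin
  have hlt : #S < #(G.inner S) := by
    by_contra! h
    nlinarith [Nat.mul_le_mul_left m h]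
  obtain ⟨l, hl⟩ := Nat.exists_eq_add_of_lt hlt
  have hlk : l + 1 ≤ k := by
    have := card_inner_add_card_le hcyc S
    omega
  have hcard : Fintype.card (S : Set V) = #S := by simp
  obtain ⟨H, hH, hv, hE⟩ := exists_subgraph_of_minimal (G := G.induce (S : Set V)) (m := m)
    (k := l + 1) (by rw [card_edgeFinset_induce, hcard, hl, add_assoc])
    (by rwa [card_edgeFinset_induce, hcard]) (by
      intro D hD
      by_contra! h
      rw [card_inner_induce, ← card_map (Function.Embedding.subtype _)] at h
      have h₁ := hSmin _ h
      rw [card_map, ← hcard] at h₁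
      exact hD ((card_eq_iff_eq_univ D).1 (le_antisymm (card_le_univ D) h₁)))
  let f : G.induce (S : Set V) →g G := (Embedding.induce (S : Set V)).toHom
  have hinj : Function.Injective f := Subtype.val_injective
  refine ⟨H.map f, ?_, ?_, ?_⟩
  · rw [Subgraph.connected_iff'] at hH ⊢
    let g : H.coe →g (H.map f).coe :=
      { toFun := fun v => ⟨f v, v, v.2, rfl⟩
        map_rel' := fun {a b} h => ⟨a, b, h, rfl, rfl⟩ }
    refine hH.map g ?_
    rintro ⟨_, v, hv, rfl⟩
    exact ⟨⟨v, hv⟩, rfl⟩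
  · rw [Subgraph.edgeSet_map, Subgraph.map_verts, Set.ncard_image_of_injective _ hinj,
      Set.ncard_image_of_injective _ (Sym2.map.injective hinj)]
    exact hv
  · rw [Subgraph.edgeSet_map, Set.ncard_image_of_injective _ (Sym2.map.injective hinj)]
    exact hE.trans (Nat.mul_le_mul_right m (Nat.mul_le_mul_left 4
      (Nat.log_mono_right (Nat.mul_le_mul_left 2 hlk))))

end
end SimpleGraph

/-- Let `Γ` be a finite simple graph such that no connected component of `Γ`
is acyclic (i.e. every vertex is in the same component as some cycle) and such that
`χ(Γ) = |V(Γ)| − |E(Γ)| < 0`.  Then `Γ` contains a connected subgraph `H` with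
`|E(H)| > |V(H)|` (i.e. `χ(H) < 0`) and with
`|E(H)| ≤ 4·log₂(2·|χ(Γ)|)·⌊|E(Γ)|/|χ(Γ)|⌋`. -/
theorem exists_short_negative_subgraph_of_no_acyclic_component {V : Type*} [Fintype V]
    (Γ : SimpleGraph V)
    (hcyc : ∀ v : V, ∃ w : V, Γ.Reachable v w ∧ ∃ p : Γ.Walk w w, p.IsCycle)
    (hχ : (Fintype.card V : ℤ) - (Γ.edgeSet.ncard : ℤ) < 0) :
    ∃ H : Γ.Subgraph, H.Connected ∧ H.verts.ncard < H.edgeSet.ncard ∧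
      (H.edgeSet.ncard : ℝ) ≤
        4 * Real.logb 2 (2 * |(Fintype.card V : ℝ) - (Γ.edgeSet.ncard : ℝ)|) *
          ((⌊(Γ.edgeSet.ncard : ℝ) / |(Fintype.card V : ℝ) - (Γ.edgeSet.ncard : ℝ)|⌋ : ℤ) : ℝ) := by
  classical
  have hcard : Γ.edgeSet.ncard = Γ.edgeFinset.card := by
    rw [← SimpleGraph.coe_edgeFinset, Set.ncard_coe_finset]
  obtain ⟨k, hk⟩ := Nat.exists_eq_add_of_lt (by omega : Fintype.card V < Γ.edgeSet.ncard)
  rw [add_assoc] at hk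
  set m := Γ.edgeSet.ncard / (k + 1) with hm
  have hdiv : Γ.edgeSet.ncard < (m + 1) * (k + 1) := by
    rw [hm, mul_comm]
    exact Nat.lt_mul_div_succ _ (Nat.succ_pos k)
  obtain ⟨H, hH, hv, hE⟩ := SimpleGraph.exists_short_subgraph (G := Γ) hcyc (m := m) (k := k + 1)
    (by rw [← hk, hcard]) (by
      have h : (m + 1) * Fintype.card V < m * Γ.edgeSet.ncard := by
        rw [hk] at hdiv ⊢
        nlinarith
      rw [hcard] at h
      convert h)
  refine ⟨H, hH, hv, ?_⟩
  have habs : |(Fintype.card V : ℝ) - (Γ.edgeSet.ncard : ℝ)| = ((k + 1 : ℕ) : ℝ) := by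
    rw [hk, Nat.cast_add, sub_add_cancel_left, abs_neg, abs_of_nonneg (Nat.cast_nonneg _)]
  have hfloor : ⌊(Γ.edgeSet.ncard : ℝ) / ((k + 1 : ℕ) : ℝ)⌋ = (m : ℤ) := by
    rw [Int.floor_div_natCast, Int.floor_natCast, hm, Int.natCast_div]
  rw [habs, hfloor, Int.cast_natCast]
  have hlog : (Nat.log 2 (2 * (k + 1)) : ℝ) ≤ Real.logb 2 (2 * ((k + 1 : ℕ) : ℝ)) := by
    have := Real.natLog_le_logb (2 * (k + 1)) 2
    push_cast at this ⊢
    exact this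
  calc (H.edgeSet.ncard : ℝ) ≤ ((4 * Nat.log 2 (2 * (k + 1)) * m : ℕ) : ℝ) := by exact_mod_cast hE
    _ = 4 * (Nat.log 2 (2 * (k + 1)) : ℝ) * m := by push_cast; ring
    _ ≤ _ := by gcongr
end
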